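/- arXiv:1710.00086 — 3 statements merged into one kernel-verified Lean document; each statement's English description precedes it below -/
import Mathlib

section
/- There are no diregular (2,k,+3)-digraphs for any k ≥ 3. That is, for k ≥ 3 there is no diregular k-geodetic digraph of degree 2 whose order is M(2,k) + 3 = 1 + 2 + 2^2 + ... + 2^k + 3. -/
/-- `p` is a directed walk from `u` to `v` in the digraph with arc relation `A`,
recorded as the list of its vertices; a walk of length `l` (i.e. with `l` arcs)
is a list of `l + 1` vertices. -/
def IsWalkFrom {V : Type*} (A : V → V → Prop) (u v : V) (p : List V) : Prop :=
  p.Chain' A ∧ p.head? = some u ∧ p.getLast? = some v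

/-- A digraph is `k`-geodetic if for every ordered pair of vertices `(u, v)`
there is at most one directed path of length at most `k` from `u` to `v`. -/
def IsKGeodetic {V : Type*} (A : V → V → Prop) (k : ℕ) : Prop :=
  ∀ (u v : V) (p q : List V), IsWalkFrom A u v p → IsWalkFrom A u v q →
    p.length ≤ k + 1 → q.length ≤ k + 1 → p = q

/-- `Nout A u = N⁺(u)`, the set of out-neighbours of `u`. -/
def Nout {V : Type*} (A : V → V → Prop) (u : V) : Set V := {v | A u v}

/-- `Nin A u = N⁻(u)`, the set of in-neighbours of `u`. -/
def Nin {V : Type*} (A : V → V → Prop) (u : V) : Set V := {v | A v u}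

/-- `NIter A l u = N^l(u)`, the set of vertices reachable from `u` by a
directed path of length exactly `l`. -/
def NIter {V : Type*} (A : V → V → Prop) (l : ℕ) (u : V) : Set V :=
  {v | ∃ p : List V, IsWalkFrom A u v p ∧ p.length = l + 1}

/-- `Ball A l u = T_l(u) = N^0(u) ∪ N^1(u) ∪ ⋯ ∪ N^l(u)`, the set of vertices
at distance at most `l` from `u`. -/
def Ball {V : Type*} (A : V → V → Prop) (l : ℕ) (u : V) : Set V :=
  {v | ∃ m ≤ l, v ∈ NIter A m u}

/-- `Outliers A k u = O(u) = {v | d(u,v) ≥ k + 1}`, the outlier set of `u`. -/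
def Outliers {V : Type*} (A : V → V → Prop) (k : ℕ) (u : V) : Set V :=
  {v | v ∉ Ball A k u}

/-- A digraph is diregular with degree `d` if every vertex has out-degree `d`
and in-degree `d`. -/
def IsDiregular {V : Type*} (A : V → V → Prop) (d : ℕ) : Prop :=
  ∀ u : V, (Nout A u).ncard = d ∧ (Nin A u).ncard = d

/-- The Moore bound `M(d,k) = 1 + d + d² + ⋯ + d^k`. -/
def moore (d k : ℕ) : ℕ := ∑ i ∈ Finset.range (k + 1), d ^ i

/-- `HasWalk A n x y`: there is a directed walk of length `n` from `x` to `y`. -/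
def HasWalk {V : Type*} (A : V → V → Prop) : ℕ → V → V → Prop
  | 0, x, y => x = y
  | n + 1, x, y => ∃ z, A x z ∧ HasWalk A n z y

/-- `IsOutlier A k x y`: no walk of length at most `k` leads from `x` to `y`. -/
def IsOutlier {V : Type*} (A : V → V → Prop) (k : ℕ) (x y : V) : Prop :=
  ∀ m ≤ k, ¬ HasWalk A m x y

section Walks

variable {V : Type*} {A : V → V → Prop}

lemma HasWalk.snoc {n : ℕ} {x y z : V} (h : HasWalk A n x y) (hyz : A y z) :
    HasWalk A (n + 1) x z := by
  induction n generalizing x with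
  | zero => cases h; exact ⟨z, hyz, rfl⟩
  | succ n ih => obtain ⟨c, hc, hcy⟩ := h; exact ⟨c, hc, ih hcy⟩

lemma HasWalk.exists_last {n : ℕ} {x z : V} (h : HasWalk A (n + 1) x z) :
    ∃ y, HasWalk A n x y ∧ A y z := by
  induction n generalizing x with
  | zero => obtain ⟨c, hc, rfl⟩ := h; exact ⟨x, rfl, hc⟩
  | succ n ih =>
    obtain ⟨c, hc, hcz⟩ := h
    obtain ⟨y, hy, hyz⟩ := ih hcz
    exact ⟨y, ⟨c, hc, hy⟩, hyz⟩

lemma HasWalk.trans {m n : ℕ} {x y z : V} (h : HasWalk A m x y) (h' : HasWalk A n y z) :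
    HasWalk A (m + n) x z := by
  induction m generalizing x with
  | zero => cases h; simpa using h'
  | succ m ih =>
    obtain ⟨c, hc, hcy⟩ := h
    rw [show m + 1 + n = m + n + 1 by omega]
    exact ⟨c, hc, ih hcy⟩

lemma HasWalk.exists_list {n : ℕ} {x y : V} (h : HasWalk A n x y) :
    ∃ p : List V, IsWalkFrom A x y (x :: p) ∧ p.length = n := by
  induction n generalizing x with
  | zero => cases h; exact ⟨[], ⟨List.isChain_singleton y, rfl, rfl⟩, rfl⟩
  | succ n ih =>
    obtain ⟨c, hc, hcy⟩ := h
    obtain ⟨p, ⟨hp, -, hl⟩, hn⟩ := ih hcy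
    refine ⟨c :: p, ⟨?_, rfl, ?_⟩, by simp [hn]⟩
    · exact List.isChain_cons_cons.2 ⟨hc, hp⟩
    · simpa using hl

lemma hasWalk_zero (x : V) : HasWalk A 0 x x := rfl

lemma hasWalk_one {x y : V} (h : A x y) : HasWalk A 1 x y := ⟨y, h, rfl⟩

lemma hasWalk_two {x y z : V} (h : A x y) (h' : A y z) : HasWalk A 2 x z :=
  ⟨y, h, z, h', rfl⟩

lemma hasWalk_three {w x y z : V} (h₀ : A w x) (h : A x y) (h' : A y z) : HasWalk A 3 w z :=
  ⟨x, h₀, y, h, z, h', rfl⟩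

lemma IsKGeodetic.length_unique {k m n : ℕ} (hg : IsKGeodetic A k) {x y : V}
    (h : HasWalk A m x y) (h' : HasWalk A n x y) (hm : m ≤ k) (hn : n ≤ k) : m = n := by
  obtain ⟨p, hp, rfl⟩ := h.exists_list
  obtain ⟨q, hq, rfl⟩ := h'.exists_list
  have := hg x y _ _ hp hq (by simpa using hm) (by simpa using hn)
  simpa using congrArg List.length this

lemma IsKGeodetic.first_unique {k m n : ℕ} (hg : IsKGeodetic A k) {x a b y : V}
    (ha : A x a) (hb : A x b) (h : HasWalk A m a y) (h' : HasWalk A n b y)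
    (hm : m < k) (hn : n < k) : a = b := by
  obtain ⟨p, ⟨hp, -, hpl⟩, rfl⟩ := h.exists_list
  obtain ⟨q, ⟨hq, -, hql⟩, rfl⟩ := h'.exists_list
  have := hg x y (x :: a :: p) (x :: b :: q)
    ⟨List.isChain_cons_cons.2 ⟨ha, hp⟩, rfl, by simpa using hpl⟩
    ⟨List.isChain_cons_cons.2 ⟨hb, hq⟩, rfl, by simpa using hql⟩
    (by simpa using hm) (by simpa using hn)
  simp only [List.cons.injEq] at this
  exact this.2.1

end Walks

/-- The properties of a diregular `(2,k,+3)`-digraph with `k ≥ 3` used in the proof. The last four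
fields express that the adjacency matrix commutes with the outlier matrix. -/
structure IsExcessThree {V : Type*} (A : V → V → Prop) (k : ℕ) : Prop where
  three_le : 3 ≤ k
  exists_out : ∀ x, ∃ a, A x a
  out_other : ∀ x a, A x a → ∃ b, b ≠ a ∧ ∀ y, A x y ↔ y = a ∨ y = b
  exists_in : ∀ x, ∃ a, A a x
  in_other : ∀ x a, A a x → ∃ b, b ≠ a ∧ ∀ y, A y x ↔ y = a ∨ y = b
  length_unique : ∀ {m n : ℕ} {x y : V}, HasWalk A m x y → HasWalk A n x y →
    m ≤ k → n ≤ k → m = n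
  first_unique : ∀ {m n : ℕ} {x a b y : V}, A x a → A x b → HasWalk A m a y → HasWalk A n b y →
    m < k → n < k → a = b
  outliers : ∀ x, ∃ a b c, a ≠ b ∧ a ≠ c ∧ b ≠ c ∧
    ∀ y, IsOutlier A k x y ↔ y = a ∨ y = b ∨ y = c
  inOutliers : ∀ y, ∃ a b c, a ≠ b ∧ a ≠ c ∧ b ≠ c ∧
    ∀ x, IsOutlier A k x y ↔ x = a ∨ x = b ∨ x = c
  outlier_child : ∀ {x a b d y : V}, a ≠ b → A x a → A x b → IsOutlier A k x d → A d y →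
    IsOutlier A k a y ∨ IsOutlier A k b y
  exists_outlier : ∀ {x a y : V}, A x a → IsOutlier A k a y →
    ∃ d, IsOutlier A k x d ∧ A d y
  outlier_both : ∀ {x a d d' y : V}, A x a → IsOutlier A k x d →
    IsOutlier A k x d' → d ≠ d' → A d y → A d' y → IsOutlier A k a y
  exists_two_outliers : ∀ {x a b y : V}, a ≠ b → A x a → A x b → IsOutlier A k a y →
    IsOutlier A k b y → ∃ d d', d ≠ d' ∧ (IsOutlier A k x d ∧ A d y) ∧
      IsOutlier A k x d' ∧ A d' y

section Matrices

lemma exists_other {V : Type*} {R : V → V → Prop} {x a : V}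
    (h : Set.ncard {y | R x y} = 2) (ha : R x a) :
    ∃ b, b ≠ a ∧ ∀ y, R x y ↔ y = a ∨ y = b := by
  obtain ⟨p, q, hpq, he⟩ := Set.ncard_eq_two.1 h
  have hm : ∀ y, R x y ↔ y = p ∨ y = q := fun y => by
    have : y ∈ {y | R x y} ↔ y ∈ ({p, q} : Set V) := by rw [he]
    simpa using this
  rcases (hm a).1 ha with rfl | rfl
  · exact ⟨q, hpq.symm, hm⟩
  · exact ⟨p, hpq, fun y => (hm y).trans or_comm⟩

open Classical in
/-- The `0/1` matrix of a relation. -/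
noncomputable def relMatrix {V : Type*} (R : V → V → Prop) : Matrix V V ℤ :=
  fun x y => if R x y then 1 else 0

variable {V : Type*} [Fintype V] {A : V → V → Prop} {k : ℕ}

open Classical in
lemma ncard_eq_sum (R : V → Prop) :
    ((Set.ncard {y | R y} : ℕ) : ℤ) = ∑ y, if R y then 1 else 0 := by
  rw [Set.ncard_eq_toFinset_card']
  simp

lemma relMatrix_pow [DecidableEq V] (hg : IsKGeodetic A k) {n : ℕ} (hn : n ≤ k) :
    relMatrix A ^ n = relMatrix (HasWalk A n) := by
  classical
  induction n with
  | zero => ext x y; by_cases h : x = y <;> simp [relMatrix, HasWalk, h]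
  | succ n ih =>
    rw [pow_succ', ih (by omega)]
    ext x y
    simp only [Matrix.mul_apply, relMatrix]
    by_cases h : HasWalk A (n + 1) x y
    · obtain ⟨z, hz, hzy⟩ := id h
      rw [if_pos h, Finset.sum_eq_single z]
      · simp [hz, hzy]
      · intro c _ hcz
        by_cases hc : A x c
        · by_cases hcy : HasWalk A n c y
          · exact absurd (hg.first_unique hc hz hcy hzy (by omega) (by omega)) hcz
          · simp [hcy]
        · simp [hc]
      · simp
    · rw [if_neg h]
      refine Finset.sum_eq_zero fun z _ => ?_
      by_cases hz : A x z
      · have : ¬ HasWalk A n z y := fun hzy => h ⟨z, hz, hzy⟩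
        simp [this]
      · simp [hz]

lemma relMatrix_isOutlier [DecidableEq V] (hg : IsKGeodetic A k) :
    relMatrix (IsOutlier A k) =
      Matrix.of (fun _ _ => 1) - ∑ i ∈ Finset.range (k + 1), relMatrix A ^ i := by
  classical
  ext x y
  rw [Matrix.sub_apply, Matrix.sum_apply]
  have hs : ∀ i ∈ Finset.range (k + 1), (relMatrix A ^ i) x y = if HasWalk A i x y then 1 else 0 :=
    fun i hi => by rw [relMatrix_pow hg (by simpa [Nat.lt_succ_iff] using hi)]; rfl
  rw [Finset.sum_congr rfl hs]
  by_cases h : IsOutlier A k x y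
  · rw [Finset.sum_eq_zero]
    · simp [relMatrix, h]
    · intro i hi
      rw [if_neg (h i (by simpa [Nat.lt_succ_iff] using hi))]
  · have h' := h
    simp only [IsOutlier, not_forall, not_not] at h'
    obtain ⟨m, hm, hw⟩ := h'
    rw [Finset.sum_eq_single m]
    · simp [relMatrix, h, hw]
    · intro i hi him
      rw [if_neg]
      exact fun hi' => him (hg.length_unique hi' hw (by simpa [Nat.lt_succ_iff] using hi) hm)
    · intro hm'; simp at hm'; omega

lemma relMatrix_mul_one (hreg : IsDiregular A 2) (x : V) : ∑ y, relMatrix A x y = 2 := by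
  classical
  have := (hreg x).1
  simp only [Nout] at this
  simp only [relMatrix, ← ncard_eq_sum, this, Nat.cast_ofNat]

lemma one_mul_relMatrix (hreg : IsDiregular A 2) (y : V) : ∑ x, relMatrix A x y = 2 := by
  classical
  have := (hreg y).2
  simp only [Nin] at this
  simp only [relMatrix, ← ncard_eq_sum (fun x => A x y), this, Nat.cast_ofNat]

lemma relMatrix_commute [DecidableEq V] (hreg : IsDiregular A 2) (hg : IsKGeodetic A k) :
    relMatrix A * relMatrix (IsOutlier A k) = relMatrix (IsOutlier A k) * relMatrix A := by
  rw [relMatrix_isOutlier hg, mul_sub, sub_mul, Finset.mul_sum, Finset.sum_mul]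
  congr 1
  · ext x y
    simp only [Matrix.mul_apply, Matrix.of_apply, mul_one, one_mul,
      relMatrix_mul_one hreg, one_mul_relMatrix hreg]
  · exact Finset.sum_congr rfl fun i _ => by rw [← pow_succ, ← pow_succ']

lemma sum_relMatrix_pow [DecidableEq V] (hreg : IsDiregular A 2) (n : ℕ) (x : V) :
    ∑ y, (relMatrix A ^ n) x y = 2 ^ n := by
  induction n with
  | zero => simp [Matrix.one_apply]
  | succ n ih =>
    simp only [pow_succ, Matrix.mul_apply]
    rw [Finset.sum_comm]
    simp only [← Finset.mul_sum, relMatrix_mul_one hreg, ← Finset.sum_mul, ih]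

lemma sum_relMatrix_pow' [DecidableEq V] (hreg : IsDiregular A 2) (n : ℕ) (y : V) :
    ∑ x, (relMatrix A ^ n) x y = 2 ^ n := by
  induction n with
  | zero => simp [Matrix.one_apply]
  | succ n ih =>
    simp only [pow_succ', Matrix.mul_apply]
    rw [Finset.sum_comm]
    simp only [← Finset.sum_mul, one_mul_relMatrix hreg, ← Finset.mul_sum, ih]

lemma exists_three_of_sum {R : V → V → Prop} {x : V} (h : ∑ y, relMatrix R x y = 3) :
    ∃ a b c, a ≠ b ∧ a ≠ c ∧ b ≠ c ∧ ∀ y, R x y ↔ y = a ∨ y = b ∨ y = c := by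
  classical
  simp only [relMatrix, ← ncard_eq_sum] at h
  obtain ⟨a, b, c, hab, hac, hbc, he⟩ := Set.ncard_eq_three.1 (by exact_mod_cast h)
  refine ⟨a, b, c, hab, hac, hbc, fun y => ?_⟩
  have : y ∈ {y | R x y} ↔ y ∈ ({a, b, c} : Set V) := by rw [he]
  simpa using this

lemma isExcessThree (hk : 3 ≤ k) (hreg : IsDiregular A 2) (hg : IsKGeodetic A k)
    (hcard : Fintype.card V = moore 2 k + 3) : IsExcessThree A k := by
  classical
  have hrow : ∀ x, ∑ y, relMatrix (IsOutlier A k) x y = 3 := fun x => by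
    rw [relMatrix_isOutlier hg]
    simp only [Matrix.sub_apply, Matrix.sum_apply, Finset.sum_sub_distrib]
    rw [Finset.sum_comm]
    simp [sum_relMatrix_pow hreg, hcard, moore]
  have hcol : ∀ y, ∑ x, relMatrix (IsOutlier A k) x y = 3 := fun x => by
    rw [relMatrix_isOutlier hg]
    simp only [Matrix.sub_apply, Matrix.sum_apply, Finset.sum_sub_distrib]
    rw [Finset.sum_comm]
    simp [sum_relMatrix_pow' hreg, hcard, moore]
  have hout : ∀ x a, A x a → ∃ b, b ≠ a ∧ ∀ y, A x y ↔ y = a ∨ y = b :=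
    fun x a ha => exists_other (hreg x).1 ha
  have hcomm : ∀ {x a b : V} (y : V), a ≠ b → A x a → A x b →
      ((if IsOutlier A k a y then 1 else 0) + (if IsOutlier A k b y then 1 else 0) : ℤ) =
        ∑ d, (if IsOutlier A k x d ∧ A d y then 1 else 0) := by
    intro x a b y hab ha hb
    have h := congrFun (congrFun (relMatrix_commute hreg hg) x) y
    simp only [Matrix.mul_apply, relMatrix] at h
    obtain ⟨b', hb', hx⟩ := hout x a ha
    obtain rfl : b = b' := ((hx b).1 hb).resolve_left hab.symm
    rw [Finset.sum_eq_add_of_mem a b (Finset.mem_univ _) (Finset.mem_univ _) hab] at h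
    · simp only [if_pos ha, if_pos hb, one_mul] at h
      rw [h]
      refine Finset.sum_congr rfl fun d _ => ?_
      by_cases h1 : IsOutlier A k x d <;> by_cases h2 : A d y <;> simp [h1, h2]
    · intro c _ hc
      rw [if_neg, zero_mul]
      intro h'
      rcases (hx c).1 h' with h | h
      · exact hc.1 h
      · exact hc.2 h
  have hnn : ∀ x y d : V, (0 : ℤ) ≤ if IsOutlier A k x d ∧ A d y then 1 else 0 := fun x y d => by
    split_ifs <;> norm_num
  refine ⟨hk, fun x => ?_, hout, fun x => ?_,
    fun x a ha => exists_other (R := fun x y => A y x) (hreg x).2 ha,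
    hg.length_unique, hg.first_unique, fun x => exists_three_of_sum (hrow x),
    fun y => exists_three_of_sum (R := fun y x => IsOutlier A k x y) (hcol y), ?_, ?_, ?_, ?_⟩
  · exact Set.nonempty_of_ncard_ne_zero (s := Nout A x) (by rw [(hreg x).1]; norm_num)
  · exact Set.nonempty_of_ncard_ne_zero (s := Nin A x) (by rw [(hreg x).2]; norm_num)
  · intro x a b d y hab ha hb hd hdy
    have h := hcomm y hab ha hb
    have h1 := Finset.single_le_sum (fun d _ => hnn x y d) (Finset.mem_univ d)
    rw [if_pos ⟨hd, hdy⟩, ← h] at h1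
    by_contra! hc
    simp [hc.1, hc.2] at h1
  · intro x a y ha hay
    obtain ⟨b, hb, hx⟩ := hout x a ha
    have h := hcomm y hb.symm ha ((hx b).2 (Or.inr rfl))
    by_contra! hc
    rw [Finset.sum_eq_zero (fun d _ => if_neg (fun hd => hc d hd.1 hd.2)), if_pos hay] at h
    split_ifs at h <;> norm_num at h
  · intro x a d d' y ha hd hd' hne hdy hdy'
    obtain ⟨b, hb, hx⟩ := hout x a ha
    have h := hcomm y hb.symm ha ((hx b).2 (Or.inr rfl))
    have h1 := Finset.sum_le_sum_of_subset_of_nonneg (Finset.subset_univ {d, d'})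
      (fun d _ _ => hnn x y d)
    rw [Finset.sum_pair hne, if_pos ⟨hd, hdy⟩, if_pos ⟨hd', hdy'⟩, ← h] at h1
    by_contra hc
    rw [if_neg hc] at h1
    split_ifs at h1 <;> norm_num at h1
  · intro x a b y hab ha hb hay hby
    have h := hcomm y hab ha hb
    rw [if_pos hay, if_pos hby] at h
    by_contra! hc
    have h1 : ∑ d, (if IsOutlier A k x d ∧ A d y then 1 else 0) ≤ (1 : ℤ) := by
      rw [Finset.sum_boole]
      norm_cast
      rw [Finset.card_le_one]
      intro d hd d' hd'
      by_contra hne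
      simp only [Finset.mem_filter, Finset.mem_univ, true_and] at hd hd'
      exact hc d d' hne hd hd'.1 hd'.2
    omega

end Matrices

/-- `IsPair A u v u₁ v₁ w`: the out-neighbourhoods `{u₁, w}` of `u` and `{v₁, w}` of `v` have
exactly the vertex `w` in common. -/
structure IsPair {V : Type*} (A : V → V → Prop) (u v u₁ v₁ w : V) : Prop where
  out_left : ∀ y, A u y ↔ y = u₁ ∨ y = w
  out_right : ∀ y, A v y ↔ y = v₁ ∨ y = w
  ne_left : u₁ ≠ w
  ne_right : v₁ ≠ w
  ne : u₁ ≠ v₁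

namespace IsPair

variable {V : Type*} {A : V → V → Prop} {u v u₁ v₁ w : V}

lemma symm (h : IsPair A u v u₁ v₁ w) : IsPair A v u v₁ u₁ w :=
  ⟨h.out_right, h.out_left, h.ne_right, h.ne_left, h.ne.symm⟩

lemma arc_left (h : IsPair A u v u₁ v₁ w) : A u u₁ := (h.out_left _).2 (Or.inl rfl)

lemma arc_right (h : IsPair A u v u₁ v₁ w) : A v v₁ := (h.out_right _).2 (Or.inl rfl)

lemma arc_left_common (h : IsPair A u v u₁ v₁ w) : A u w := (h.out_left _).2 (Or.inr rfl)

lemma arc_right_common (h : IsPair A u v u₁ v₁ w) : A v w := (h.out_right _).2 (Or.inr rfl)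

lemma base_ne (h : IsPair A u v u₁ v₁ w) : u ≠ v := by
  rintro rfl
  exact ((h.out_right _).1 h.arc_left).elim h.ne h.ne_left

end IsPair

lemma exists_hasWalk_of_not_isOutlier {V : Type*} {A : V → V → Prop} {k : ℕ} {x y : V}
    (h : ¬ IsOutlier A k x y) : ∃ m ≤ k, HasWalk A m x y := by
  simpa [IsOutlier] using h

namespace IsExcessThree

variable {V : Type*} {A : V → V → Prop} {k : ℕ}

lemma no_cycle (hA : IsExcessThree A k) {m : ℕ} {x : V} (h : HasWalk A m x x) (hm : 1 ≤ m)
    (hmk : m ≤ k) : False := by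
  have := hA.length_unique h (hasWalk_zero x) hmk (by omega)
  omega

lemma not_loop (hA : IsExcessThree A k) {x : V} (h : A x x) : False :=
  hA.no_cycle (hasWalk_one h) le_rfl (by have := hA.three_le; omega)

lemma no_two_cycle (hA : IsExcessThree A k) {x y : V} (h : A x y) (h' : A y x) : False :=
  hA.no_cycle (hasWalk_two h h') (by omega) (by have := hA.three_le; omega)

lemma no_three_cycle (hA : IsExcessThree A k) {x y z : V} (h : A x y) (h' : A y z) (h'' : A z x) :
    False :=
  hA.no_cycle (hasWalk_three h h' h'') (by omega) hA.three_le

lemma no_transitive (hA : IsExcessThree A k) {x y z : V} (h : A x y) (h' : A y z) (h'' : A x z) :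
    False := by
  have hk := hA.three_le
  exact absurd (hA.length_unique (hasWalk_one h'') (hasWalk_two h h') (by omega) (by omega))
    (by omega)

lemma eq_of_common_child (hA : IsExcessThree A k) {x a b y : V} (ha : A x a) (hb : A x b)
    (hay : A a y) (hby : A b y) : a = b :=
  hA.first_unique ha hb (hasWalk_one hay) (hasWalk_one hby) (by have := hA.three_le; omega)
    (by have := hA.three_le; omega)

lemma exists_out_pair (hA : IsExcessThree A k) (x : V) :
    ∃ a b, a ≠ b ∧ ∀ y, A x y ↔ y = a ∨ y = b := by
  obtain ⟨a, ha⟩ := hA.exists_out x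
  obtain ⟨b, hb, hx⟩ := hA.out_other x a ha
  exact ⟨a, b, hb.symm, hx⟩

lemma exists_walk (hA : IsExcessThree A k) (m : ℕ) (x : V) : ∃ y, HasWalk A m x y := by
  induction m generalizing x with
  | zero => exact ⟨x, rfl⟩
  | succ m ih =>
    obtain ⟨a, ha⟩ := hA.exists_out x
    obtain ⟨y, hy⟩ := ih a
    exact ⟨y, a, ha, hy⟩

lemma exists_four_walks (hA : IsExcessThree A k) {m : ℕ} (hm : 2 ≤ m) (x : V) :
    ∃ a b c d, (a ≠ b ∧ a ≠ c ∧ a ≠ d ∧ b ≠ c ∧ b ≠ d ∧ c ≠ d) ∧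
      HasWalk A m x a ∧ HasWalk A m x b ∧ HasWalk A m x c ∧ HasWalk A m x d := by
  obtain ⟨n, rfl⟩ := Nat.exists_eq_add_of_le' hm
  obtain ⟨z, hz⟩ := hA.exists_walk n x
  obtain ⟨p, q, hpq, hzz⟩ := hA.exists_out_pair z
  obtain ⟨a, b, hab, hp⟩ := hA.exists_out_pair p
  obtain ⟨c, d, hcd, hq⟩ := hA.exists_out_pair q
  have hzp := (hzz p).2 (Or.inl rfl)
  have hzq := (hzz q).2 (Or.inr rfl)
  have hpa := (hp a).2 (Or.inl rfl)
  have hpb := (hp b).2 (Or.inr rfl)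
  have hqc := (hq c).2 (Or.inl rfl)
  have hqd := (hq d).2 (Or.inr rfl)
  have hne : ∀ {y y'}, A p y → A q y' → y ≠ y' := fun hy hy' h =>
    hpq (hA.eq_of_common_child hzp hzq hy (h ▸ hy'))
  refine ⟨a, b, c, d, ⟨hab, hne hpa hqc, hne hpa hqd, hne hpb hqc, hne hpb hqd, hcd⟩,
    hz.trans (hasWalk_two hzp hpa),
    hz.trans (hasWalk_two hzp hpb), hz.trans (hasWalk_two hzq hqc), hz.trans (hasWalk_two hzq hqd)⟩

lemma eq_of_isOutlier (hA : IsExcessThree A k) {x a b c : V} (hab : a ≠ b) (hac : a ≠ c)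
    (hbc : b ≠ c) (ha : IsOutlier A k x a) (hb : IsOutlier A k x b) (hc : IsOutlier A k x c) {y : V}
    (hy : IsOutlier A k x y) : y = a ∨ y = b ∨ y = c := by
  obtain ⟨p, q, r, -, -, -, h⟩ := hA.outliers x
  rw [h] at ha hb hc hy
  grind

lemma eq_of_isOutlier_left (hA : IsExcessThree A k) {y a b c : V} (hab : a ≠ b) (hac : a ≠ c)
    (hbc : b ≠ c) (ha : IsOutlier A k a y) (hb : IsOutlier A k b y) (hc : IsOutlier A k c y) {x : V}
    (hx : IsOutlier A k x y) : x = a ∨ x = b ∨ x = c := by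
  obtain ⟨p, q, r, -, -, -, h⟩ := hA.inOutliers y
  rw [h] at ha hb hc hx
  grind

lemma isOutlier_of_subset (hA : IsExcessThree A k) {x a b c : V}
    (h : ∀ y, IsOutlier A k x y → y = a ∨ y = b ∨ y = c) : IsOutlier A k x b := by
  obtain ⟨p, q, r, hpq, hpr, hqr, h'⟩ := hA.outliers x
  have hp := h p ((h' p).2 (by simp))
  have hq := h q ((h' q).2 (by simp))
  have hr := h r ((h' r).2 (by simp))
  rw [h']
  grind

/-- The vertices at the end of the walks of length `m ≥ 2` from `x` are too many to lie, up to one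
exception, in an outlier set that has another element. -/
lemma not_all_outliers (hA : IsExcessThree A k) {m : ℕ} {x c v e : V} (hm : 2 ≤ m)
    (h : ∀ y, HasWalk A m x y → y = v ∨ IsOutlier A k c y) (he : IsOutlier A k c e)
    (hne : ¬ HasWalk A m x e) : False := by
  obtain ⟨p, q, r, s, hd, hp, hq, hr, hs⟩ := hA.exists_four_walks hm x
  obtain ⟨a, b, d, -, -, -, h'⟩ := hA.outliers c
  have hp' : p ≠ e := fun h => hne (h ▸ hp)
  have hq' : q ≠ e := fun h => hne (h ▸ hq)
  have hr' : r ≠ e := fun h => hne (h ▸ hr)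
  have hs' : s ≠ e := fun h => hne (h ▸ hs)
  have h1 := h p hp
  have h2 := h q hq
  have h3 := h r hr
  have h4 := h s hs
  rw [h'] at h1 h2 h3 h4 he
  clear h h' hne hp hq hr hs hA
  have hle : ({p, q, r, s, e} : Set V).ncard ≤ ({v, a, b, d} : Set V).ncard := by
    refine Set.ncard_le_ncard ?_ (Set.toFinite _)
    intro y hy
    simp only [Set.mem_insert_iff, Set.mem_singleton_iff] at hy ⊢
    rcases hy with rfl | rfl | rfl | rfl | rfl
    · exact h1
    · exact h2
    · exact h3
    · exact h4
    · exact Or.inr he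
  have h5 : ({p, q, r, s, e} : Set V).ncard = 5 := by
    obtain ⟨h1, h2, h3, h4, h5, h6⟩ := hd
    rw [Set.ncard_insert_of_notMem, Set.ncard_insert_of_notMem, Set.ncard_insert_of_notMem,
      Set.ncard_pair hs'] <;> simp [*]
  have h4 : ({v, a, b, d} : Set V).ncard ≤ 4 := by
    refine (Set.ncard_insert_le _ _).trans (Nat.succ_le_succ ((Set.ncard_insert_le _ _).trans ?_))
    refine Nat.succ_le_succ ((Set.ncard_insert_le _ _).trans ?_)
    simp
  omega

section Pair

variable {u v u₁ v₁ w : V}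

lemma le_of_walk_to_right (hA : IsExcessThree A k) (h : IsPair A u v u₁ v₁ w) {m : ℕ}
    (hw : HasWalk A m u₁ v) : k ≤ m + 1 := by
  by_contra! hm
  exact h.ne_left (hA.first_unique h.arc_left h.arc_left_common (hw.snoc h.arc_right_common)
    (hasWalk_zero w) hm (by omega))

lemma isOutlier_or_walk (hA : IsExcessThree A k) (h : IsPair A u v u₁ v₁ w) :
    IsOutlier A k u v ∨ HasWalk A (k - 1) u₁ v := by
  rw [or_iff_not_imp_left]
  intro hn
  obtain ⟨m, hm, hw⟩ := exists_hasWalk_of_not_isOutlier hn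
  cases m with
  | zero => exact absurd hw h.base_ne
  | succ m =>
    obtain ⟨z, hz, hzv⟩ := hw
    rcases (h.out_left z).1 hz with rfl | rfl
    · have := hA.le_of_walk_to_right h hzv
      obtain rfl : m = k - 1 := by omega
      exact hzv
    · exact (hA.no_cycle (hzv.snoc h.arc_right_common) (by omega) hm).elim

lemma reach_right (hA : IsExcessThree A k) (h : IsPair A u v u₁ v₁ w) {s : ℕ} {z : V}
    (hz : HasWalk A s u₁ z) (hs : s < k) :
    z = v ∨ IsOutlier A k v z ∨ ∃ t < k, HasWalk A t v₁ z := by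
  by_cases ho : IsOutlier A k v z
  · exact Or.inr (Or.inl ho)
  obtain ⟨m, hm, hw⟩ := exists_hasWalk_of_not_isOutlier ho
  cases m with
  | zero => exact Or.inl hw.symm
  | succ m =>
    obtain ⟨c, hc, hcz⟩ := hw
    rcases (h.out_right c).1 hc with rfl | rfl
    · exact Or.inr (Or.inr ⟨m, hm, hcz⟩)
    · exact absurd (hA.first_unique h.arc_left h.arc_left_common hz hcz hs hm) h.ne_left

lemma eq_or_isOutlier_of_walks (hA : IsExcessThree A k) (h : IsPair A u v u₁ v₁ w) {s t j : ℕ}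
    {z y : V} (hs : HasWalk A s u₁ z) (ht : HasWalk A t v₁ z) (hst : s < t) (hj : HasWalk A j z y)
    (htj : t + j = k) : y = v ∨ IsOutlier A k v y := by
  rcases hA.reach_right h (hs.trans hj) (by omega) with hy | hy | ⟨t', ht', hy⟩
  · exact Or.inl hy
  · exact Or.inr hy
  · have := hA.length_unique hy (ht.trans hj) (by omega) (by omega)
    omega

lemma isOutlier_right (hA : IsExcessThree A k) (h : IsPair A u v u₁ v₁ w) :
    IsOutlier A k v u₁ := by
  have hk := hA.three_le
  by_contra hn
  have hself : HasWalk A 0 u₁ u₁ := rfl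
  obtain ⟨t, ht, hw⟩ : ∃ t < k, HasWalk A t v₁ u₁ := by
    rcases hA.reach_right h hself (by omega) with hz | hz | hz
    · have := hA.le_of_walk_to_right h (m := 0) hz
      omega
    · exact absurd hz hn
    · exact hz
  have ht0 : 0 < t := by
    rcases Nat.eq_zero_or_pos t with rfl | ht0
    · exact absurd hw h.ne.symm
    · exact ht0
  have hvu : IsOutlier A k v u := by
    refine (hA.isOutlier_or_walk h.symm).resolve_right fun hu => ?_
    have := hA.length_unique hw (hu.snoc h.arc_left) (by omega) (by omega)
    omega
  have hnear : ∀ y, HasWalk A (k - t) u₁ y → y = v ∨ IsOutlier A k v y := fun y hy =>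
    hA.eq_or_isOutlier_of_walks h hself hw ht0 hy (by omega)
  by_cases hkt : 2 ≤ k - t
  · exact hA.not_all_outliers hkt hnear hvu fun hy =>
      hA.no_cycle (hy.snoc h.arc_left) (by omega) (by omega)
  rw [show k - t = 1 by omega] at hnear
  have hchild : ∀ c, A u₁ c → IsOutlier A k v c := fun c hc => by
    refine (hnear c (hasWalk_one hc)).resolve_left ?_
    rintro rfl
    have := hA.le_of_walk_to_right h (hasWalk_one hc)
    omega
  obtain ⟨c, d, hcd, hout⟩ := hA.exists_out_pair u₁
  have hc := (hout c).2 (Or.inl rfl)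
  have hd := (hout d).2 (Or.inr rfl)
  have huc : u ≠ c := by rintro rfl; exact hA.no_two_cycle hc h.arc_left
  have hud : u ≠ d := by rintro rfl; exact hA.no_two_cycle hd h.arc_left
  have hwu : IsOutlier A k w u₁ :=
    (hA.outlier_child h.ne_right h.arc_right h.arc_right_common hvu h.arc_left).resolve_left
      fun ho => ho t ht.le hw
  refine hA.not_all_outliers (x := u₁) (v := v) le_rfl ?_ hwu
    fun hy => hA.no_cycle hy (by omega) (by omega)
  rintro z ⟨e, he, y, hy, rfl⟩
  rw [or_iff_not_imp_left]
  intro hyv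
  refine (hA.outlier_child h.ne_right h.arc_right h.arc_right_common (hchild e he) hy).resolve_left
    fun ho => ?_
  rcases hA.reach_right h (hasWalk_two he hy) (by omega) with hz | hz | ⟨s, hs, hz⟩
  · exact hyv hz
  · rcases hA.eq_of_isOutlier huc hud hcd hvu (hchild c hc) (hchild d hd) hz with rfl | rfl | rfl
    · exact hA.no_three_cycle h.arc_left he hy
    · exact hA.no_transitive he hy hc
    · exact hA.no_transitive he hy hd
  · exact ho s hs.le hz

lemma in_common (hA : IsExcessThree A k) (h : IsPair A u v u₁ v₁ w) {p : V} (hp : A p w) :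
    p = u ∨ p = v := by
  obtain ⟨b, hb, hin⟩ := hA.in_other w u h.arc_left_common
  obtain rfl : v = b := ((hin v).1 h.arc_right_common).resolve_left h.base_ne.symm
  exact (hin p).1 hp

lemma isOutlier_of_arc_left (hA : IsExcessThree A k) (h : IsPair A u v u₁ v₁ w) {p : V}
    (hp : A p u₁) (hpu : p ≠ u) : IsOutlier A k p w := by
  obtain ⟨b, hb, hout⟩ := hA.out_other p u₁ hp
  have hpw : ¬ A p w := fun hpw => by
    obtain rfl := (hA.in_common h hpw).resolve_left hpu
    exact ((h.out_right _).1 hp).elim h.ne h.ne_left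
  refine hA.isOutlier_right (u := u) (u₁ := w) (v := p) (v₁ := b) (w := u₁)
    ⟨fun y => (h.out_left y).trans or_comm, fun y => (hout y).trans or_comm, h.ne_left.symm, hb, ?_⟩
  rintro rfl
  exact hpw ((hout _).2 (Or.inr rfl))

lemma out_left_ne_out_right (hA : IsExcessThree A k) (h : IsPair A u v u₁ v₁ w)
    (heq : ∀ y, A u₁ y ↔ A v₁ y) : False := by
  have key : ∀ {u v u₁ v₁ : V}, IsPair A u v u₁ v₁ w → (∀ y, A u₁ y ↔ A v₁ y) →
      IsOutlier A k u₁ w := by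
    intro u v u₁ v₁ h heq
    have hk := hA.three_le
    have huv : IsOutlier A k u v := by
      refine (hA.isOutlier_or_walk h).resolve_right fun hw => ?_
      obtain ⟨n, hn⟩ : ∃ n, k - 1 = n + 1 := ⟨k - 2, by omega⟩
      rw [hn] at hw
      obtain ⟨x, hx, hxv⟩ := hw
      exact hA.no_cycle (hxv.trans (hasWalk_two h.arc_right ((heq x).1 hx))) (by omega) (by omega)
    exact (hA.outlier_child h.ne_left h.arc_left h.arc_left_common huv
      h.arc_right_common).resolve_right fun ho => ho 0 (by omega) rfl
  have h1 := key h heq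
  have h2 := key h.symm fun y => (heq y).symm
  obtain ⟨x, hux⟩ := hA.exists_out u₁
  have hvx := (heq x).1 hux
  obtain ⟨p, hpu, hp⟩ := hA.in_other u₁ u h.arc_left
  obtain ⟨q, hqv, hq⟩ := hA.in_other v₁ v h.arc_right
  have hp := (hp p).2 (Or.inr rfl)
  have hq := (hq q).2 (Or.inr rfl)
  have hpq : p ≠ q := by
    rintro rfl
    exact h.ne (hA.eq_of_common_child hp hq hux hvx)
  have hpu₁ : p ≠ u₁ := by rintro rfl; exact hA.not_loop hp
  have hpv₁ : p ≠ v₁ := by rintro rfl; exact hA.no_transitive hp hux hvx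
  have hqu₁ : q ≠ u₁ := by rintro rfl; exact hA.no_transitive hq hvx hux
  have hqv₁ : q ≠ v₁ := by rintro rfl; exact hA.not_loop hq
  rcases hA.eq_of_isOutlier_left h.ne hqu₁.symm hqv₁.symm h1 h2
    (hA.isOutlier_of_arc_left h.symm hq hqv) (hA.isOutlier_of_arc_left h hp hpu) with h' | h' | h'
  exacts [hpu₁ h', hpv₁ h', hpq h']

end Pair

lemma isOutlier_second (hA : IsExcessThree A k) {a b a₁ b₁ a₂ b₂ c c₁ c₂ : V}
    (h : IsPair A a b a₁ b₁ c) (h₁ : IsPair A a₁ b₁ a₂ b₂ c₁) (ha : A a₂ c₂) (hb : A b₂ c₂) :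
    IsOutlier A k b a₂ := by
  have hk := hA.three_le
  by_contra hn
  have hself := hasWalk_one h₁.arc_left
  obtain ⟨t, ht, hw⟩ : ∃ t < k, HasWalk A t b₁ a₂ := by
    rcases hA.reach_right h hself (by omega) with rfl | hz | hz
    · have := hA.le_of_walk_to_right h hself
      omega
    · exact absurd hz hn
    · exact hz
  have ht2 : 2 ≤ t := by
    by_contra! ht2
    interval_cases t
    · cases hw
      exact hA.isOutlier_right h.symm 2 (by omega) (hasWalk_two h.arc_left h₁.arc_left)
    · obtain ⟨z, hz, rfl⟩ := hw
      exact ((h₁.out_right _).1 hz).elim h₁.ne h₁.ne_left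
  have hnear : ∀ y, HasWalk A (k - t) a₂ y → y = b ∨ IsOutlier A k b y := fun y hy =>
    hA.eq_or_isOutlier_of_walks h hself hw ht2 hy (by omega)
  by_cases hkt : 2 ≤ k - t
  · exact hA.not_all_outliers hkt hnear (hA.isOutlier_right h) fun hy =>
      hA.no_cycle (hy.snoc h₁.arc_left) (by omega) (by omega)
  rw [show k - t = 1 by omega] at hnear
  rcases hnear c₂ (hasWalk_one ha) with rfl | ho
  · exact hA.no_three_cycle h.arc_right h₁.arc_right hb
  · exact ho 3 hk (hasWalk_three h.arc_right h₁.arc_right hb)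

lemma no_chain (hA : IsExcessThree A k) {a b a₁ b₁ a₂ b₂ a₃ b₃ c c₁ c₂ x : V}
    (h : IsPair A a b a₁ b₁ c) (h₁ : IsPair A a₁ b₁ a₂ b₂ c₁) (h₂ : IsPair A a₂ b₂ a₃ b₃ c₂)
    (ha : A a₃ x) (hb : A b₃ x) : False := by
  have hk := hA.three_le
  have hc : IsOutlier A k c c₂ :=
    (hA.outlier_child h.ne_left h.arc_left h.arc_left_common
      (hA.isOutlier_second h.symm h₁.symm h₂.arc_right_common h₂.arc_left_common)
      h₂.arc_right_common).resolve_left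
      fun ho => ho 2 (by omega) (hasWalk_two h₁.arc_left h₂.arc_left_common)
  have hc₁ : IsOutlier A k c₁ c₂ :=
    (hA.outlier_child h₁.ne_left h₁.arc_left h₁.arc_left_common (hA.isOutlier_right h₁.symm)
      h₂.arc_right_common).resolve_left
      fun ho => ho 1 (by omega) (hasWalk_one h₂.arc_left_common)
  obtain ⟨p, hp2, hp⟩ := hA.in_other a₃ a₂ h₂.arc_left
  obtain ⟨q, hq2, hq⟩ := hA.in_other b₃ b₂ h₂.arc_right
  have hp := (hp p).2 (Or.inr rfl)
  have hq := (hq q).2 (Or.inr rfl)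
  have hpq : p ≠ q := by
    rintro rfl
    exact h₂.ne (hA.eq_of_common_child hp hq ha hb)
  have hne : c ≠ c₁ := by
    rintro rfl
    exact hA.no_transitive h.arc_left h₁.arc_left_common h.arc_left_common
  have hnc : ∀ {a b a₁ b₁ a₂ b₂ a₃ b₃ p : V}, IsPair A a b a₁ b₁ c → IsPair A a₁ b₁ a₂ b₂ c₁ →
      IsPair A a₂ b₂ a₃ b₃ c₂ → A p a₃ → p ≠ c ∧ p ≠ c₁ := by
    intro a b a₁ b₁ a₂ b₂ a₃ b₃ p h h₁ h₂ hp
    constructor <;> rintro rfl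
    · exact h.ne_left (hA.first_unique h.arc_left h.arc_left_common
        (hasWalk_two h₁.arc_left h₂.arc_left) (hasWalk_one hp) (by omega) (by omega))
    · exact h₁.ne_left (hA.eq_of_common_child h₁.arc_left h₁.arc_left_common h₂.arc_left hp)
  obtain ⟨hpc, hpc₁⟩ := hnc h h₁ h₂ hp
  obtain ⟨hqc, hqc₁⟩ := hnc h.symm h₁.symm h₂.symm hq
  rcases hA.eq_of_isOutlier_left hne hqc.symm hqc₁.symm hc hc₁
    (hA.isOutlier_of_arc_left h₂.symm hq hq2) (hA.isOutlier_of_arc_left h₂ hp hp2) with h' | h' | h'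
  exacts [hpc h', hpc₁ h', hpq h']

section Disjoint

variable {u v u₁ v₁ w : V}

lemma eq_or_isOutlier_of_child (hA : IsExcessThree A k) (h : IsPair A u v u₁ v₁ w)
    (hdisj : ∀ z, A u₁ z → ¬ A v₁ z) {c d : V} (hc : A u₁ c) (hvc : ¬ IsOutlier A k v c)
    (hd : A c d) : d = v ∨ IsOutlier A k v d := by
  have hk := hA.three_le
  obtain ⟨t, ht, hw⟩ : ∃ t < k, HasWalk A t v₁ c := by
    rcases hA.reach_right h (hasWalk_one hc) (by omega) with rfl | hz | hz
    · have := hA.le_of_walk_to_right h (hasWalk_one hc)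
      omega
    · exact absurd hz hvc
    · exact hz
  have ht2 : 2 ≤ t := by
    by_contra! ht2
    interval_cases t
    · cases hw
      exact hA.isOutlier_right h.symm 2 (by omega) (hasWalk_two h.arc_left hc)
    · obtain ⟨z, hz, rfl⟩ := hw
      exact hdisj z hc hz
  have hnear : ∀ y, HasWalk A (k - t) c y → y = v ∨ IsOutlier A k v y := fun y hy =>
    hA.eq_or_isOutlier_of_walks h (hasWalk_one hc) hw ht2 hy (by omega)
  by_cases hkt : 2 ≤ k - t
  · exact (hA.not_all_outliers hkt hnear (hA.isOutlier_right h) fun hy =>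
      hA.no_cycle (hy.snoc hc) (by omega) (by omega)).elim
  rw [show k - t = 1 by omega] at hnear
  exact hnear d (hasWalk_one hd)

lemma not_isOutlier_of_walk_two (hA : IsExcessThree A k) (h : IsPair A u v u₁ v₁ w) {c d z : V}
    (hc : IsOutlier A k v c) (hd : IsOutlier A k v d) (hcd : c ≠ d)
    (hout : ∀ y, A u₁ y ↔ y = c ∨ y = d) (hz : HasWalk A 2 u₁ z) (hzv : z ≠ v) :
    IsOutlier A k w z := by
  have hk := hA.three_le
  have hc₁ := (hout c).2 (Or.inl rfl)
  have hd₁ := (hout d).2 (Or.inr rfl)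
  obtain ⟨e, he, y, hy, rfl⟩ := id hz
  have hve : IsOutlier A k v e := by rcases (hout e).1 he with rfl | rfl <;> assumption
  refine (hA.outlier_child h.ne_right h.arc_right h.arc_right_common hve hy).resolve_left
    fun ho => ?_
  rcases hA.reach_right h hz (by omega) with h' | h' | ⟨s, hs, h'⟩
  · exact hzv h'
  · rcases hA.eq_of_isOutlier (a := u₁) (b := c) (c := d) (by rintro rfl; exact hA.not_loop hc₁)
      (by rintro rfl; exact hA.not_loop hd₁) hcd (hA.isOutlier_right h) hc hd h' with rfl | rfl | rfl
    · exact hA.no_two_cycle he hy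
    · exact hA.no_transitive he hy hc₁
    · exact hA.no_transitive he hy hd₁
  · exact ho s hs.le h'

lemma exists_walk_two_to_right (hA : IsExcessThree A k) (h : IsPair A u v u₁ v₁ w)
    (hdisj : ∀ z, A u₁ z → ¬ A v₁ z) : HasWalk A 2 u₁ v := by
  have hk := hA.three_le
  by_contra hn
  have hvu := hA.isOutlier_right h
  have key : ∀ c c', A u₁ c → A u₁ c' → c ≠ c' → IsOutlier A k v c := by
    intro c c' hc hc' hcc
    by_contra hvc
    have hout : ∀ e d, A u₁ e → ¬ IsOutlier A k v e → A e d → IsOutlier A k v d :=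
      fun e d he hve hd => (hA.eq_or_isOutlier_of_child h hdisj he hve hd).resolve_left
        (by rintro rfl; exact hn (hasWalk_two he hd))
    obtain ⟨d, d', hdd, hd⟩ := hA.exists_out_pair c
    have hcd := (hd d).2 (Or.inl rfl)
    have hcd' := (hd d').2 (Or.inr rfl)
    have hud : u₁ ≠ d := by rintro rfl; exact hA.no_two_cycle hc hcd
    have hud' : u₁ ≠ d' := by rintro rfl; exact hA.no_two_cycle hc hcd'
    have hall := fun y => hA.eq_of_isOutlier (y := y) hud hud' hdd hvu (hout c d hc hvc hcd)
      (hout c d' hc hvc hcd')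
    by_cases hvc' : IsOutlier A k v c'
    · rcases hall c' hvc' with rfl | rfl | rfl
      · exact hA.not_loop hc'
      · exact hA.no_transitive hc hcd hc'
      · exact hA.no_transitive hc hcd' hc'
    · obtain ⟨e, he⟩ := hA.exists_out c'
      rcases hall e (hout c' e hc' hvc' he) with rfl | rfl | rfl
      · exact hA.no_two_cycle hc' he
      · exact hcc (hA.eq_of_common_child hc hc' hcd he)
      · exact hcc (hA.eq_of_common_child hc hc' hcd' he)
  obtain ⟨c, d, hcd, hout⟩ := hA.exists_out_pair u₁
  have hc := (hout c).2 (Or.inl rfl)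
  have hd := (hout d).2 (Or.inr rfl)
  have hw : ∀ z, HasWalk A 2 u₁ z → IsOutlier A k w z := fun z hz =>
    hA.not_isOutlier_of_walk_two h (key c d hc hd hcd) (key d c hd hc hcd.symm) hcd hout hz
      (by rintro rfl; exact hn hz)
  obtain ⟨p, q, r, s, ⟨h1, h2, h3, h4, h5, h6⟩, hp, hq, hr, hs⟩ :=
    hA.exists_four_walks le_rfl u₁
  rcases hA.eq_of_isOutlier h1 h2 h4 (hw p hp) (hw q hq) (hw r hr) (hw s hs) with h' | h' | h'
  exacts [h3 h'.symm, h5 h'.symm, h6 h'.symm]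

end Disjoint

/-- The out-neighbours of `u₁` are `c` and `d`, and those of `c` are `v` and `s`. -/
structure IsBranch (A : V → V → Prop) (v u₁ c d s : V) : Prop where
  out : ∀ y, A u₁ y ↔ y = c ∨ y = d
  ne : c ≠ d
  out_left : ∀ y, A c y ↔ y = v ∨ y = s
  ne_target : v ≠ s

lemma exists_isBranch (hA : IsExcessThree A k) {v u₁ : V} (h : HasWalk A 2 u₁ v) :
    ∃ c d s, IsBranch A v u₁ c d s := by
  obtain ⟨c, hc, z, hcv, rfl⟩ := h
  obtain ⟨d, hd, hout⟩ := hA.out_other u₁ c hc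
  obtain ⟨s, hs, hout'⟩ := hA.out_other c z hcv
  exact ⟨c, d, s, hout, hd.symm, hout', hs.symm⟩

namespace IsBranch

variable {v u₁ c d s : V}

lemma arc_left (h : IsBranch A v u₁ c d s) : A u₁ c := (h.out _).2 (Or.inl rfl)

lemma arc_right (h : IsBranch A v u₁ c d s) : A u₁ d := (h.out _).2 (Or.inr rfl)

lemma arc_target (h : IsBranch A v u₁ c d s) : A c v := (h.out_left _).2 (Or.inl rfl)

lemma arc_other (h : IsBranch A v u₁ c d s) : A c s := (h.out_left _).2 (Or.inr rfl)

end IsBranch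

section Branch

variable {u v u₁ v₁ w c d s c' d' s' : V}

lemma not_arc_of_arc_left (hA : IsExcessThree A k) (hb : IsBranch A v u₁ c d s) {y : V}
    (hy : A c y) : ¬ A d y :=
  fun hd => hb.ne (hA.eq_of_common_child hb.arc_left hb.arc_right hy hd)

lemma isOutlier_branch_right (hA : IsExcessThree A k) (h : IsPair A u v u₁ v₁ w)
    (hdisj : ∀ z, A u₁ z → ¬ A v₁ z) (hb : IsBranch A v u₁ c d s) : IsOutlier A k v d := by
  by_contra hn
  have hvu := hA.isOutlier_right h
  obtain ⟨p, q, hpq, hout⟩ := hA.exists_out_pair d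
  have hp := (hout p).2 (Or.inl rfl)
  have hq := (hout q).2 (Or.inr rfl)
  have ho : ∀ y, A d y → IsOutlier A k v y := fun y hy =>
    (hA.eq_or_isOutlier_of_child h hdisj hb.arc_right hn hy).resolve_left
      (by rintro rfl; exact hA.not_arc_of_arc_left hb hb.arc_target hy)
  have hup : u₁ ≠ p := by rintro rfl; exact hA.no_two_cycle hb.arc_right hp
  have huq : u₁ ≠ q := by rintro rfl; exact hA.no_two_cycle hb.arc_right hq
  have hall := fun y => hA.eq_of_isOutlier (y := y) hup huq hpq hvu (ho p hp) (ho q hq)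
  by_cases hvc : IsOutlier A k v c
  · rcases hall c hvc with rfl | rfl | rfl
    · exact hA.not_loop hb.arc_left
    · exact hA.no_transitive hb.arc_right hp hb.arc_left
    · exact hA.no_transitive hb.arc_right hq hb.arc_left
  · have hs := (hA.eq_or_isOutlier_of_child h hdisj hb.arc_left hvc hb.arc_other).resolve_left
      hb.ne_target.symm
    rcases hall s hs with rfl | rfl | rfl
    · exact hA.no_two_cycle hb.arc_left hb.arc_other
    · exact hA.not_arc_of_arc_left hb hb.arc_other hp
    · exact hA.not_arc_of_arc_left hb hb.arc_other hq

lemma outliers_common_of_isOutlier (hA : IsExcessThree A k) (h : IsPair A u v u₁ v₁ w)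
    (hdisj : ∀ z, A u₁ z → ¬ A v₁ z) (hb : IsBranch A v u₁ c d s) (hc : IsOutlier A k v c) (y : V) :
    IsOutlier A k w y ↔ y = s ∨ A d y := by
  have hd := hA.isOutlier_branch_right h hdisj hb
  obtain ⟨p, q, hpq, hout⟩ := hA.exists_out_pair d
  have hp := (hout p).2 (Or.inl rfl)
  have hq := (hout q).2 (Or.inr rfl)
  have hw : ∀ z, HasWalk A 2 u₁ z → z ≠ v → IsOutlier A k w z := fun z =>
    hA.not_isOutlier_of_walk_two h hc hd hb.ne hb.out
  have hws := hw s (hasWalk_two hb.arc_left hb.arc_other) hb.ne_target.symm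
  have hwd : ∀ z, A d z → IsOutlier A k w z := fun z hz => hw z (hasWalk_two hb.arc_right hz)
    (by rintro rfl; exact hA.not_arc_of_arc_left hb hb.arc_target hz)
  have hsd : ∀ z, A d z → s ≠ z := by
    rintro z hz rfl
    exact hA.not_arc_of_arc_left hb hb.arc_other hz
  rw [hout]
  refine ⟨fun hy => hA.eq_of_isOutlier (hsd p hp) (hsd q hq) hpq hws (hwd p hp) (hwd q hq) hy, ?_⟩
  rintro (rfl | rfl | rfl)
  exacts [hws, hwd _ hp, hwd _ hq]

lemma outliers_right_child_of_isOutlier (hA : IsExcessThree A k) (h : IsPair A u v u₁ v₁ w)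
    (hdisj : ∀ z, A u₁ z → ¬ A v₁ z) (hb : IsBranch A v u₁ c d s) (hc : IsOutlier A k v c) (y : V) :
    IsOutlier A k v₁ y ↔ y = c ∨ y = d ∨ y = v := by
  have hd := hA.isOutlier_branch_right h hdisj hb
  have hw := hA.outliers_common_of_isOutlier h hdisj hb hc
  have hstep : ∀ {e z}, IsOutlier A k v e → A e z → ¬ (z = s ∨ A d z) → IsOutlier A k v₁ z :=
    fun he hz hn => (hA.outlier_child h.ne_right h.arc_right h.arc_right_common he hz).resolve_right
      (by rwa [hw])
  have hcv : c ≠ v := by rintro rfl; exact hA.not_loop hb.arc_target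
  have hdv : d ≠ v := by rintro rfl; exact hA.no_transitive hb.arc_left hb.arc_target hb.arc_right
  have h1 : IsOutlier A k v₁ c := hstep (hA.isOutlier_right h) hb.arc_left (by
    rintro (rfl | h')
    · exact hA.not_loop hb.arc_other
    · exact hA.no_transitive hb.arc_right h' hb.arc_left)
  have h2 : IsOutlier A k v₁ d := hstep (hA.isOutlier_right h) hb.arc_right (by
    rintro (rfl | h')
    · exact hA.no_transitive hb.arc_left hb.arc_other hb.arc_right
    · exact hA.not_loop h')
  have h3 : IsOutlier A k v₁ v := hstep hc hb.arc_target (by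
    rintro (h' | h')
    · exact hb.ne_target h'
    · exact hA.not_arc_of_arc_left hb hb.arc_target h')
  refine ⟨hA.eq_of_isOutlier hb.ne hcv hdv h1 h2 h3, ?_⟩
  rintro (rfl | rfl | rfl) <;> assumption

lemma isOutlier_other_of_not_isOutlier (hA : IsExcessThree A k) (h : IsPair A u v u₁ v₁ w)
    (hdisj : ∀ z, A u₁ z → ¬ A v₁ z) (hb : IsBranch A v u₁ c d s) (hc : ¬ IsOutlier A k v c) :
    IsOutlier A k v s :=
  (hA.eq_or_isOutlier_of_child h hdisj hb.arc_left hc hb.arc_other).resolve_left hb.ne_target.symm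

lemma eq_three_of_branch (hA : IsExcessThree A k) (h : IsPair A u v u₁ v₁ w)
    (hb : IsBranch A v u₁ c d s) : k = 3 := by
  have := hA.le_of_walk_to_right h (hasWalk_two hb.arc_left hb.arc_target)
  have := hA.three_le
  omega

lemma walk_of_not_isOutlier (hA : IsExcessThree A k) (h : IsPair A u v u₁ v₁ w)
    (hdisj : ∀ z, A u₁ z → ¬ A v₁ z) (hb : IsBranch A v u₁ c d s) (hc : ¬ IsOutlier A k v c) :
    HasWalk A 2 v₁ c := by
  have hk := hA.eq_three_of_branch h hb
  rcases hA.reach_right h (hasWalk_one hb.arc_left) (by omega) with rfl | hz | ⟨t, ht, hw⟩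
  · exact (hA.not_loop hb.arc_target).elim
  · exact absurd hz hc
  · have ht3 : t < 3 := by omega
    interval_cases t
    · cases hw
      exact (hA.isOutlier_right h.symm 2 (by omega) (hasWalk_two h.arc_left hb.arc_left)).elim
    · obtain ⟨z, hz, rfl⟩ := hw
      exact (hdisj z hb.arc_left hz).elim
    · exact hw

lemma outliers_common_of_not_isOutlier (hA : IsExcessThree A k) (h : IsPair A u v u₁ v₁ w)
    (hdisj : ∀ z, A u₁ z → ¬ A v₁ z) (hb : IsBranch A v u₁ c d s) (hc : ¬ IsOutlier A k v c)
    (y : V) : IsOutlier A k w y ↔ y = c ∨ A d y := by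
  have hk := hA.eq_three_of_branch h hb
  have hd := hA.isOutlier_branch_right h hdisj hb
  have hs := hA.isOutlier_other_of_not_isOutlier h hdisj hb hc
  have hu := hA.isOutlier_right h
  have hud : u₁ ≠ d := by rintro rfl; exact hA.not_loop hb.arc_right
  have hus : u₁ ≠ s := by rintro rfl; exact hA.no_two_cycle hb.arc_left hb.arc_other
  have hds : d ≠ s := by rintro rfl; exact hA.no_transitive hb.arc_left hb.arc_other hb.arc_right
  obtain ⟨p, q, hpq, hout⟩ := hA.exists_out_pair d
  have hp := (hout p).2 (Or.inl rfl)
  have hq := (hout q).2 (Or.inr rfl)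
  have hwc : IsOutlier A k w c :=
    (hA.outlier_child h.ne_right h.arc_right h.arc_right_common hu hb.arc_left).resolve_left
      fun ho => ho 2 (by omega) (hA.walk_of_not_isOutlier h hdisj hb hc)
  have hwd : ∀ z, A d z → IsOutlier A k w z := by
    intro z hz
    refine (hA.outlier_child h.ne_right h.arc_right h.arc_right_common hd hz).resolve_left
      fun ho => ?_
    rcases hA.reach_right h (hasWalk_two hb.arc_right hz) (by omega) with rfl | h' | ⟨t, ht, h'⟩
    · exact hA.not_arc_of_arc_left hb hb.arc_target hz
    · rcases hA.eq_of_isOutlier hud hus hds hu hd hs h' with rfl | rfl | rfl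
      · exact hA.no_two_cycle hb.arc_right hz
      · exact hA.not_loop hz
      · exact hA.not_arc_of_arc_left hb hb.arc_other hz
    · exact ho t ht.le h'
  have hcd : ∀ z, A d z → c ≠ z := by
    rintro z hz rfl
    exact hA.no_transitive hb.arc_right hz hb.arc_left
  rw [hout]
  refine ⟨fun hy => hA.eq_of_isOutlier (hcd p hp) (hcd q hq) hpq hwc (hwd p hp) (hwd q hq) hy, ?_⟩
  rintro (rfl | rfl | rfl)
  exacts [hwc, hwd _ hp, hwd _ hq]

/-- Otherwise `d` and the corresponding out-neighbour of `v₁` form a new pair, in which the walks of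
length two guaranteed by disjointness cannot exist. -/
lemma isOutlier_or_isOutlier (hA : IsExcessThree A k) (h : IsPair A u v u₁ v₁ w)
    (hdisj : ∀ z, A u₁ z → ¬ A v₁ z) (hb : IsBranch A v u₁ c d s) (hb' : IsBranch A u v₁ c' d' s') :
    IsOutlier A k v c ∨ IsOutlier A k u c' := by
  by_contra! hn
  have hk := hA.eq_three_of_branch h hb
  have hdisj' : ∀ z, A v₁ z → ¬ A u₁ z := fun z hz hz' => hdisj z hz' hz
  have hw := hA.outliers_common_of_not_isOutlier h hdisj hb hn.1
  have hw' := hA.outliers_common_of_not_isOutlier h.symm hdisj' hb' hn.2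
  have hcc : c ≠ c' := by rintro rfl; exact hdisj c hb.arc_left hb'.arc_left
  have hdc : A d c' := ((hw c').1 ((hw' c').2 (Or.inl rfl))).resolve_left hcc.symm
  have hdc' : A d' c := ((hw' c).1 ((hw c).2 (Or.inl rfl))).resolve_left hcc
  obtain ⟨g, hg, hd⟩ := hA.out_other d c' hdc
  obtain ⟨g', hg', hd'⟩ := hA.out_other d' c hdc'
  obtain rfl : g = g' := by
    have hdg := (hd g).2 (Or.inr rfl)
    have := (hw' g).1 ((hw g).2 (Or.inr hdg))
    rcases this with rfl | h'
    · exact absurd rfl hg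
    rcases (hd' g).1 h' with rfl | h'
    · exact (hA.no_transitive hb.arc_right hdg hb.arc_left).elim
    · exact h'
  have hs' := hA.isOutlier_other_of_not_isOutlier h.symm hdisj' hb' hn.2
  have hpair : IsPair A d d' c' c g := ⟨hd, hd', hg.symm, hg'.symm, hcc.symm⟩
  have hdisj'' : ∀ z, A c' z → ¬ A c z := by
    intro z hz hz'
    rcases (hb'.out_left z).1 hz with rfl | rfl
    · exact hA.no_three_cycle h.arc_left hb.arc_left hz'
    · rcases (hb.out_left z).1 hz' with rfl | rfl
      · exact hA.no_three_cycle h.arc_right hb'.arc_left hz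
      · exact hs' 3 (by omega) (hasWalk_three h.arc_left hb.arc_left hz')
  obtain ⟨e, he, y, hy, rfl⟩ := hA.exists_walk_two_to_right hpair hdisj''
  rcases (hb'.out_left e).1 he with rfl | rfl
  · rcases (h.out_left y).1 hy with rfl | rfl
    · exact hA.isOutlier_right h 2 (by omega) (hasWalk_two h.arc_right hb'.arc_right)
    · exact hA.no_transitive h.arc_right hb'.arc_right h.arc_right_common
  · have hne : v₁ ≠ e := by rintro rfl; exact hA.no_two_cycle hb'.arc_left he
    have := hA.outlier_both h.arc_left_common (hA.isOutlier_right h.symm) hs' hne hb'.arc_right hy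
    rcases (hw' y).1 this with rfl | h'
    · exact hb'.ne rfl
    · exact hA.not_loop h'

lemma branches_of_isOutlier (hA : IsExcessThree A k) (h : IsPair A u v u₁ v₁ w)
    (hdisj : ∀ z, A u₁ z → ¬ A v₁ z) (hb : IsBranch A v u₁ c d s) (hb' : IsBranch A u v₁ c' d' s')
    (hc : IsOutlier A k v c) :
    IsOutlier A k u c' ∧ s = s' ∧ (∀ y, A d y → A d' y) ∧
      ∀ y, IsOutlier A k d' y → y = s ∨ y = v₁ ∨ y = w := by
  have hk := hA.eq_three_of_branch h hb
  have hdisj' : ∀ z, A v₁ z → ¬ A u₁ z := fun z hz hz' => hdisj z hz' hz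
  have hw := hA.outliers_common_of_isOutlier h hdisj hb hc
  have hv₁ := hA.outliers_right_child_of_isOutlier h hdisj hb hc
  have hw' : ∀ y, IsOutlier A k w y → y = s' ∨ y = c' ∨ A d' y := by
    intro y hy
    by_cases hc' : IsOutlier A k u c'
    · exact ((hA.outliers_common_of_isOutlier h.symm hdisj' hb' hc' y).1 hy).imp_right Or.inr
    · exact Or.inr ((hA.outliers_common_of_not_isOutlier h.symm hdisj' hb' hc' y).1 hy)
  have hsw := (hw s).2 (Or.inl rfl)
  have hc'v : IsOutlier A k c' v := by
    obtain ⟨e, he, hev⟩ := hA.exists_outlier hb'.arc_target (hA.isOutlier_right h.symm)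
    obtain ⟨f, hf, hfe⟩ := hA.exists_outlier hb'.arc_left he
    have hnw : ¬ IsOutlier A k w e := by
      intro ho
      rcases hw' e ho with rfl | rfl | h'
      · exact hA.no_three_cycle hb'.arc_left hb'.arc_other hev
      · exact hA.no_two_cycle hb'.arc_left hev
      · exact hA.no_three_cycle hb'.arc_right h' hev
    rw [hw] at hnw
    rcases (hv₁ f).1 hf with rfl | rfl | rfl
    · rcases (hb.out_left e).1 hfe with rfl | h'
      · exact he
      · exact (hnw (Or.inl h')).elim
    · exact (hnw (Or.inr hfe)).elim
    · rcases (h.out_right e).1 hfe with rfl | rfl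
      · exact (hA.not_loop hev).elim
      · exact (hA.no_transitive h.arc_right_common hev h.arc_right).elim
  have hd'v : ¬ IsOutlier A k d' v := by
    intro ho
    have key : ∀ f, IsOutlier A k v₁ f → A f v → f = c := by
      intro f hf hfv
      rcases (hv₁ f).1 hf with rfl | rfl | rfl
      · rfl
      · exact (hA.not_arc_of_arc_left hb hb.arc_target hfv).elim
      · exact (hA.not_loop hfv).elim
    obtain ⟨f, f', hne, ⟨hf, hfv⟩, hf', hfv'⟩ :=
      hA.exists_two_outliers hb'.ne hb'.arc_left hb'.arc_right hc'v ho
    exact hne ((key f hf hfv).trans (key f' hf' hfv').symm)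
  have hss : s = s' := by
    rcases hw' s hsw with h' | rfl | h'
    · exact h'
    · have := hA.length_unique (hasWalk_one hb.arc_other)
        (hasWalk_three hb.arc_target h.arc_right hb'.arc_left) (by omega) (by omega)
      omega
    · obtain ⟨b, hbs, hout⟩ := hA.out_other d' s h'
      refine (hd'v (hA.isOutlier_right (u := c) (u₁ := v) (v := d') (v₁ := b) (w := s)
        ⟨hb.out_left, fun y => (hout y).trans or_comm, hb.ne_target, hbs, ?_⟩)).elim
      rintro rfl
      exact hA.no_three_cycle h.arc_right hb'.arc_right ((hout _).2 (Or.inr rfl))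
  subst hss
  have hc' : IsOutlier A k u c' := by
    by_contra hc'
    rcases (hA.outliers_common_of_not_isOutlier h.symm hdisj' hb' hc' s).1 hsw with rfl | h'
    · exact hA.not_loop hb'.arc_other
    · exact hA.not_arc_of_arc_left hb' hb'.arc_other h'
  have hdd : ∀ y, A d y → A d' y := by
    intro y hy
    refine ((hA.outliers_common_of_isOutlier h.symm hdisj' hb' hc' y).1
      ((hw y).2 (Or.inr hy))).resolve_left ?_
    rintro rfl
    exact hA.not_arc_of_arc_left hb hb.arc_other hy
  refine ⟨hc', rfl, hdd, fun y hy => ?_⟩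
  obtain ⟨f, hf, hfy⟩ := hA.exists_outlier hb'.arc_right hy
  rcases (hv₁ f).1 hf with rfl | rfl | rfl
  · rcases (hb.out_left y).1 hfy with rfl | rfl
    · exact (hd'v hy).elim
    · exact Or.inl rfl
  · exact (hy 1 (by omega) (hasWalk_one (hdd y hfy))).elim
  · exact Or.inr ((h.out_right y).1 hfy)

lemma not_isOutlier_branch (hA : IsExcessThree A k) (h : IsPair A u v u₁ v₁ w)
    (hdisj : ∀ z, A u₁ z → ¬ A v₁ z) (hb : IsBranch A v u₁ c d s)
    (hb' : IsBranch A u v₁ c' d' s') : ¬ IsOutlier A k v c := by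
  intro hc
  obtain ⟨hc', rfl, hdd, hd'⟩ := hA.branches_of_isOutlier h hdisj hb hb' hc
  obtain ⟨-, -, -, hd⟩ :=
    hA.branches_of_isOutlier h.symm (fun z hz hz' => hdisj z hz' hz) hb' hb hc'
  obtain ⟨p, q, hpq, hout⟩ := hA.exists_out_pair d
  have hp := (hout p).2 (Or.inl rfl)
  have hq := (hout q).2 (Or.inr rfl)
  have key : ∀ p, A d p → ¬ IsOutlier A k p c := by
    intro p hp ho
    obtain ⟨f, hf, hfc⟩ := hA.exists_outlier (hdd p hp) ho
    rcases hd' f hf with rfl | rfl | rfl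
    · exact hA.no_two_cycle hb.arc_other hfc
    · exact hdisj c hb.arc_left hfc
    · exact h.ne_left (hA.eq_of_common_child h.arc_left h.arc_left_common hb.arc_left hfc)
  exact (hA.outlier_child hpq hp hq (hA.isOutlier_of_subset hd) hb.arc_left).elim
    (key p hp) (key q hq)

end Branch

lemma exists_common_child (hA : IsExcessThree A k) {u v u₁ v₁ w : V} (h : IsPair A u v u₁ v₁ w) :
    ∃ x, A u₁ x ∧ A v₁ x := by
  by_contra! hdisj
  have hdisj' : ∀ z, A v₁ z → ¬ A u₁ z := fun z hz hz' => hdisj z hz' hz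
  obtain ⟨c, d, s, hb⟩ := hA.exists_isBranch (hA.exists_walk_two_to_right h hdisj)
  obtain ⟨c', d', s', hb'⟩ := hA.exists_isBranch (hA.exists_walk_two_to_right h.symm hdisj')
  exact (hA.isOutlier_or_isOutlier h hdisj hb hb').elim (hA.not_isOutlier_branch h hdisj hb hb')
    (hA.not_isOutlier_branch h.symm hdisj' hb' hb)

lemma exists_isPair_children (hA : IsExcessThree A k) {u v u₁ v₁ w : V}
    (h : IsPair A u v u₁ v₁ w) : ∃ u₂ v₂ x, IsPair A u₁ v₁ u₂ v₂ x := by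
  obtain ⟨x, hux, hvx⟩ := hA.exists_common_child h
  obtain ⟨p, hp, hu⟩ := hA.out_other u₁ x hux
  obtain ⟨q, hq, hv⟩ := hA.out_other v₁ x hvx
  refine ⟨p, q, x, fun y => (hu y).trans or_comm, fun y => (hv y).trans or_comm, hp, hq, ?_⟩
  rintro rfl
  exact hA.out_left_ne_out_right h fun y => (hu y).trans (hv y).symm

lemma not_isPair (hA : IsExcessThree A k) {u v u₁ v₁ w : V} : ¬ IsPair A u v u₁ v₁ w := by
  intro h
  obtain ⟨u₂, v₂, w₁, h₁⟩ := hA.exists_isPair_children h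
  obtain ⟨u₃, v₃, w₂, h₂⟩ := hA.exists_isPair_children h₁
  obtain ⟨x, hux, hvx⟩ := hA.exists_common_child h₂
  exact hA.no_chain h h₁ h₂ hux hvx

lemma out_eq_of_common_child (hA : IsExcessThree A k) {u v x : V} (hu : A u x) (hv : A v x) (y : V) :
    A u y ↔ A v y := by
  obtain ⟨p, hp, hu'⟩ := hA.out_other u x hu
  obtain ⟨q, hq, hv'⟩ := hA.out_other v x hv
  obtain rfl : p = q := by
    by_contra hpq
    exact hA.not_isPair (u := u) (v := v) (u₁ := p) (v₁ := q) (w := x)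
      ⟨fun y => (hu' y).trans or_comm, fun y => (hv' y).trans or_comm, hp, hq, hpq⟩
  exact (hu' y).trans (hv' y).symm

lemma isOutlier_of_common_child (hA : IsExcessThree A k) {u v x : V} (huv : u ≠ v) (hu : A u x)
    (hv : A v x) : IsOutlier A k u v := by
  intro m hm hw
  cases m with
  | zero => exact huv hw
  | succ m =>
    obtain ⟨z, hz, hzv⟩ := hw
    exact hA.no_cycle (hzv.snoc ((hA.out_eq_of_common_child hu hv z).1 hz)) (by omega) hm

lemma isEmpty (hA : IsExcessThree A k) : IsEmpty V := by
  refine ⟨fun u => ?_⟩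
  have hk := hA.three_le
  obtain ⟨x, hux⟩ := hA.exists_out u
  obtain ⟨u', huu', hin⟩ := hA.in_other x u hux
  have hu'x := (hin u').2 (Or.inr rfl)
  have siblings : ∀ y : V, ∃ p y', y' ≠ y ∧ A p y ∧ A p y' ∧ ∀ q, A q y' → A q y := by
    intro y
    obtain ⟨p, hp⟩ := hA.exists_in y
    obtain ⟨y', hy', hout⟩ := hA.out_other p y hp
    have hpy' := (hout y').2 (Or.inr rfl)
    exact ⟨p, y', hy', hp, hpy', fun q hq => (hA.out_eq_of_common_child hpy' hq y).1 hp⟩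
  obtain ⟨p, s, hsu, hpu, hps, hs⟩ := siblings u
  obtain ⟨p', s', hsu', hpu', hps', hs'⟩ := siblings u'
  obtain ⟨c, hxc⟩ := hA.exists_out x
  obtain ⟨x', hxx', hin'⟩ := hA.in_other c x hxc
  have hx'c := (hin' x').2 (Or.inr rfl)
  have h1 : IsOutlier A k u u' := hA.isOutlier_of_common_child huu'.symm hux hu'x
  have h2 : IsOutlier A k u s := by
    intro m hm hw
    cases m with
    | zero => exact hsu hw.symm
    | succ m =>
      obtain ⟨y, hy, hys⟩ := hw.exists_last
      exact hA.no_cycle (hy.snoc (hs y hys)) (by omega) hm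
  have h3 : IsOutlier A k u s' := by
    intro m hm hw
    cases m with
    | zero =>
      cases hw
      exact huu' (hA.eq_of_common_child hpu' hps' hu'x hux)
    | succ m =>
      obtain ⟨y, hy, hys⟩ := hw.exists_last
      exact h1 (m + 1) hm (hy.snoc (hs' y hys))
  have hus : u' ≠ s := by
    rintro rfl
    exact huu' (hA.eq_of_common_child hps hpu hu'x hux)
  have hss : s ≠ s' := by
    rintro rfl
    exact huu' (hA.eq_of_common_child (hs' p hps) hpu hu'x hux)
  obtain ⟨d, hd, hdx⟩ := hA.exists_outlier hux (hA.isOutlier_of_common_child hxx'.symm hxc hx'c)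
  rcases hA.eq_of_isOutlier hus hsu'.symm hss h1 h2 h3 hd with rfl | rfl | rfl
  · exact hxx' (hA.eq_of_common_child hdx hu'x hx'c hxc)
  · exact hsu (hA.first_unique hps hpu (hasWalk_two hdx hx'c) (hasWalk_two hux hxc)
      (by omega) (by omega))
  · exact hsu' (hA.first_unique hps' hpu' (hasWalk_two hdx hx'c) (hasWalk_two hu'x hxc)
      (by omega) (by omega))

end IsExcessThree

/-- There are no diregular `(2,k,+3)`-digraphs for `k ≥ 3`. -/
theorem no_diregular_2_k_plus3 {V : Type*} [Fintype V] (A : V → V → Prop) (k : ℕ)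
    (hk : 3 ≤ k) (hirr : Irreflexive A) (hreg : IsDiregular A 2)
    (hgeo : IsKGeodetic A k) :
    Fintype.card V ≠ moore 2 k + 3 := by
  intro hcard
  have := (isExcessThree hk hreg hgeo hcard).isEmpty
  rw [Fintype.card_eq_zero] at hcard
  omega
end

section
/- There are no diregular (2,3,+3)-digraphs; that is, there is no diregular 3-geodetic digraph of degree 2 on M(2,3) + 3 = 18 vertices. -/
/-- A digraph on the vertices `0, …, 17`, given by its lists of out-neighbours
(empty beyond the end of the list). -/
abbrev Pattern := List (List (Fin 18))

namespace Pattern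

def succs (F : Pattern) (a : Fin 18) : List (Fin 18) := F.getD a.val []

def hasArc (F : Pattern) (a b : Fin 18) : Bool := (F.succs a).any fun c => c.val.beq b.val

def preds (F : Pattern) (b : Fin 18) : List (Fin 18) :=
  (List.finRange 18).filter fun a => F.hasArc a b

/-- The arc relation of a pattern. -/
def Arc (F : Pattern) (a b : Fin 18) : Prop := F.hasArc a b = true

lemma arc_iff {F : Pattern} {a b : Fin 18} : F.Arc a b ↔ b ∈ F.succs a := by
  simp only [Arc, hasArc, List.any_eq_true, Nat.beq_eq]
  constructor
  · rintro ⟨c, hc, h⟩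
    rwa [← Fin.ext h]
  · exact fun h => ⟨b, h, rfl⟩

lemma mem_preds {F : Pattern} {a b : Fin 18} : a ∈ F.preds b ↔ F.Arc a b := by
  simp [preds, Arc]

end Pattern

/-- The vertices reached from `v` by at most `n` steps of the neighbour map `N`. -/
def reach {α : Type*} (N : α → List α) : ℕ → α → List α
  | 0, v => [v]
  | n + 1, v => v :: (N v).flatMap (reach N n)

lemma exists_walk_of_mem_reach {α : Type*} {N : α → List α} {R : α → α → Prop}
    (hN : ∀ a b, b ∈ N a → R a b) {n : ℕ} {v w : α} (h : w ∈ reach N n v) :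
    ∃ p, IsWalkFrom R v w p ∧ p.length ≤ n + 1 := by
  induction n generalizing v with
  | zero =>
    obtain rfl : w = v := by simpa [reach] using h
    exact ⟨[w], ⟨List.isChain_singleton _, rfl, rfl⟩, by simp⟩
  | succ n ih =>
    simp only [reach, List.mem_cons, List.mem_flatMap] at h
    rcases h with rfl | ⟨c, hc, h⟩
    · exact ⟨[w], ⟨List.isChain_singleton _, rfl, rfl⟩, by simp⟩
    · obtain ⟨p, ⟨hp, hhead, hlast⟩, hlen⟩ := ih h
      obtain _ | ⟨c', p⟩ := p
      · simp at hhead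
      · obtain rfl : c' = c := by simpa using hhead
        refine ⟨v :: c' :: p, ⟨List.isChain_cons_cons.2 ⟨hN _ _ hc, hp⟩, rfl, ?_⟩, ?_⟩
        · simpa using hlast
        · simpa using hlen

lemma IsWalkFrom.reverse {α : Type*} {R : α → α → Prop} {v w : α} {p : List α}
    (h : IsWalkFrom (fun a b => R b a) v w p) : IsWalkFrom R w v p.reverse :=
  ⟨List.isChain_reverse.2 h.1, by simpa using h.2.2, by simpa using h.2.1⟩

lemma IsWalkFrom.append {α : Type*} {R : α → α → Prop} {u a b w : α} {p q : List α}
    (hp : IsWalkFrom R u a p) (hq : IsWalkFrom R b w q) (hab : R a b) :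
    IsWalkFrom R u w (p ++ q) := by
  refine ⟨List.isChain_append.2 ⟨hp.1, hq.1, ?_⟩, ?_, ?_⟩
  · intro x hx y hy
    rw [hp.2.2] at hx
    rw [hq.2.1] at hy
    cases hx
    cases hy
    exact hab
  · simp [List.head?_append, hp.2.1]
  · simp [List.getLast?_append, hq.2.2]

lemma IsWalkFrom.map {α β : Type*} {R : α → α → Prop} {S : β → β → Prop} {f : α → β}
    (hf : ∀ a b, R a b → S (f a) (f b)) {u v : α} {p : List α} (h : IsWalkFrom R u v p) :
    IsWalkFrom S (f u) (f v) (p.map f) :=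
  ⟨(List.isChain_map f).2 (h.1.imp hf), by simp [h.2.1], by simp [h.2.2]⟩

namespace Pattern

/-- The arc `(a, b)` completes a second walk of length at most `3` between two vertices,
or gives a vertex three out-neighbours or three in-neighbours. -/
def conflict (F : Pattern) (a b : Fin 18) : Bool :=
  (F.succs a).any (fun c => (F.succs a).any fun d => !c.val.beq d.val) ||
  ((F.preds b).any fun c => (F.preds b).any fun d => !c.val.beq d.val) ||
  [0, 1, 2].any fun i =>
    (reach F.preds i a).any fun u => (reach F.succs 3 u).any fun w =>
      (reach F.succs (2 - i) b).any fun z => w.val.beq z.val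

/-- Apply a sequence of transpositions to `i`. -/
def applySwaps (l : List (Fin 18 × Fin 18)) (i : Fin 18) : Fin 18 :=
  l.foldl (fun i t => bif i.val.beq t.1.val then t.2 else bif i.val.beq t.2.val then t.1 else i) i

lemma applySwaps_injective (l : List (Fin 18 × Fin 18)) :
    Function.Injective (applySwaps l) := by
  induction l with
  | nil => exact fun _ _ h => h
  | cons t l ih =>
    have : applySwaps (t :: l) = applySwaps l ∘ Equiv.swap t.1 t.2 := by
      funext i
      simp [applySwaps, Equiv.swap_apply_def, Fin.ext_iff, cond_eq_ite]
    rw [this]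
    exact ih.comp (Equiv.injective _)

/-- The vertex map `σ` embeds `H` into `F` with the arc `(a, b)` added. -/
def embeds (H F : Pattern) (a b : Fin 18) (σ : Fin 18 → Fin 18) : Bool :=
  (List.finRange 18).all fun c => (H.succs c).all fun d =>
    F.hasArc (σ c) (σ d) || ((σ c).val.beq a.val && (σ d).val.beq b.val)

/-- `A` has no injective copy of the pattern `F`. -/
def Avoided {V : Type*} (A : V → V → Prop) (F : Pattern) : Prop :=
  ∀ f : Fin 18 → V, Function.Injective f → ¬ ∀ a b, F.Arc a b → A (f a) (f b)

end Pattern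

/-- An inductive step in the refutation of a pattern: one of the missing out-neighbours
(if `out`) or in-neighbours of `vertex` is considered. Every choice either creates a conflict or,
by an entry `(y, j, l)` of `copies`, creates a copy of the pattern refuted `j + 1` steps before. -/
structure Branching where
  pattern : Pattern
  out : Bool
  vertex : Fin 18
  copies : List (Fin 18 × ℕ × List (Fin 18 × Fin 18))

namespace Branching

/-- All choices of the arc `(a, b)` where `y` is the new neighbour are refuted. -/
def refutes (s : Branching) (db : List Pattern) (y a b : Fin 18) : Bool :=
  s.pattern.hasArc a b || s.pattern.conflict a b ||
  s.copies.any fun c => match db[c.2.1]? with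
    | some H => H.embeds s.pattern a b (Pattern.applySwaps (c.2.2 ++ [(c.1, y)]))
    | none => false

def check (s : Branching) (db : List Pattern) : Bool :=
  match s.out with
  | true => ((s.pattern.succs s.vertex).length.blt 2) &&
      (List.finRange 18).all fun y => s.refutes db y s.vertex y
  | false => ((s.pattern.preds s.vertex).length.blt 2) &&
      (List.finRange 18).all fun y => s.refutes db y y s.vertex

def checkAll : List Branching → List Pattern → Bool
  | [], _ => true
  | s :: t, db => s.check db && checkAll t (s.pattern :: db)

end Branching

section Soundness

variable {V : Type*} {A : V → V → Prop}

lemma eq_or_eq_of_ncard_eq_two {α : Type*} {s : Set α} (hs : s.ncard = 2) {x y z : α}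
    (hx : x ∈ s) (hy : y ∈ s) (hz : z ∈ s) (hxy : x ≠ y) : z = x ∨ z = y := by
  obtain ⟨p, q, -, rfl⟩ := Set.ncard_eq_two.1 hs
  simp only [Set.mem_insert_iff, Set.mem_singleton_iff] at hx hy hz
  grind

lemma exists_ne_of_ncard_eq_two {α : Type*} {s : Set α} (hs : s.ncard = 2) :
    ∃ x ∈ s, ∃ y ∈ s, x ≠ y := by
  obtain ⟨p, q, h, rfl⟩ := Set.ncard_eq_two.1 hs
  exact ⟨p, by simp, q, by simp, h⟩

lemma List.eq_of_mem_of_length_lt_two {α : Type*} {l : List α} (hl : l.length < 2) {x y : α}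
    (hx : x ∈ l) (hy : y ∈ l) : x = y := by
  match l, hl with
  | [], _ => simp at hx
  | [_], _ => simp_all

lemma Pattern.arc_of_conflict (hreg : IsDiregular A 2) (hgeo : IsKGeodetic A 3) {F : Pattern}
    {f : Fin 18 → V} (hf : Function.Injective f) (hF : ∀ a b, F.Arc a b → A (f a) (f b))
    {a b : Fin 18} (hab : A (f a) (f b)) (h : F.conflict a b = true) : F.Arc a b := by
  simp only [conflict, Bool.or_eq_true, List.any_eq_true, Bool.not_eq_true', Nat.beq_eq,
    ← Bool.not_eq_true] at h
  obtain (⟨c, hc, d, hd, hcd⟩ | ⟨c, hc, d, hd, hcd⟩) | ⟨i, hi, u, hu, w, hw, z, hz, hwz⟩ := h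
  · rw [← arc_iff] at hc hd
    have hcd' : f c ≠ f d := fun h => hcd (congrArg Fin.val (hf h))
    rcases eq_or_eq_of_ncard_eq_two (hreg (f a)).1 (hF _ _ hc) (hF _ _ hd) hab hcd' with h | h
    · rwa [hf h]
    · rwa [hf h]
  · rw [mem_preds] at hc hd
    have hcd' : f c ≠ f d := fun h => hcd (congrArg Fin.val (hf h))
    rcases eq_or_eq_of_ncard_eq_two (hreg (f b)).2 (hF _ _ hc) (hF _ _ hd) hab hcd' with h | h
    · rwa [hf h]
    · rwa [hf h]
  · obtain rfl := Fin.ext hwz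
    have hi : i ≤ 2 := by
      simp only [List.mem_cons, List.not_mem_nil, or_false] at hi
      omega
    have hsucc : ∀ a b, b ∈ F.succs a → F.Arc a b := fun _ _ => arc_iff.2
    obtain ⟨p, hp, hpl⟩ := exists_walk_of_mem_reach (R := fun a b => F.Arc b a)
      (fun _ _ => mem_preds.1) hu
    obtain ⟨q, hq, hql⟩ := exists_walk_of_mem_reach hsucc hz
    obtain ⟨r, hr, hrl⟩ := exists_walk_of_mem_reach hsucc hw
    have key := hgeo _ _ _ _ ((hp.reverse.map hF).append (hq.map hF) hab) (hr.map hF)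
      (by simp only [List.length_append, List.length_map, List.length_reverse]; omega)
      (by simpa using hrl)
    rw [← List.map_append] at key
    have hrw := hf.list_map key
    have hchain := hr.1
    rw [← hrw] at hchain
    exact (List.isChain_append.1 hchain).2.2 a (by rw [hp.reverse.2.2]; rfl) b
      (by rw [hq.2.1]; rfl)

lemma Branching.arc_of_refutes (hreg : IsDiregular A 2) (hgeo : IsKGeodetic A 3) {s : Branching}
    {db : List Pattern} (hdb : ∀ H ∈ db, H.Avoided A) {f : Fin 18 → V}
    (hf : Function.Injective f) (hF : ∀ a b, s.pattern.Arc a b → A (f a) (f b))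
    {y a b : Fin 18} (hab : A (f a) (f b)) (h : s.refutes db y a b = true) :
    s.pattern.Arc a b := by
  simp only [refutes, Bool.or_eq_true, List.any_eq_true] at h
  rcases h with (h | h) | ⟨c, -, h⟩
  · exact h
  · exact Pattern.arc_of_conflict hreg hgeo hf hF hab h
  · split at h
    · rename_i H hH
      refine (hdb H (List.mem_of_getElem? hH) _
        (hf.comp (Pattern.applySwaps_injective (c.2.2 ++ [(c.1, y)]))) fun p q hpq => ?_).elim
      simp only [Pattern.embeds, List.all_eq_true, Bool.or_eq_true, Bool.and_eq_true,
        Nat.beq_eq] at h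
      rcases h p (List.mem_finRange p) q (Pattern.arc_iff.1 hpq) with h | ⟨h₁, h₂⟩
      · exact hF _ _ h
      · simpa only [Function.comp_apply, Fin.ext h₁, Fin.ext h₂] using hab
    · cases h

lemma Branching.avoided_of_check [Fintype V] (hcard : Fintype.card V = 18)
    (hreg : IsDiregular A 2)
    (hgeo : IsKGeodetic A 3) {s : Branching} {db : List Pattern} (hdb : ∀ H ∈ db, H.Avoided A)
    (h : s.check db = true) : s.pattern.Avoided A := by
  intro f hf hF
  have hsurj : Function.Surjective f :=
    ((Fintype.bijective_iff_injective_and_card f).2 ⟨hf, by simp [hcard]⟩).2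
  unfold check at h
  split at h <;> simp only [Bool.and_eq_true, List.all_eq_true, Nat.blt_eq] at h
  · obtain ⟨x, hx, y, hy, hxy⟩ := exists_ne_of_ncard_eq_two (hreg (f s.vertex)).1
    obtain ⟨x, rfl⟩ := hsurj x
    obtain ⟨y, rfl⟩ := hsurj y
    have hx' := arc_of_refutes hreg hgeo hdb hf hF hx (h.2 x (List.mem_finRange x))
    have hy' := arc_of_refutes hreg hgeo hdb hf hF hy (h.2 y (List.mem_finRange y))
    exact hxy (congrArg f (List.eq_of_mem_of_length_lt_two h.1 (Pattern.arc_iff.1 hx')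
      (Pattern.arc_iff.1 hy')))
  · obtain ⟨x, hx, y, hy, hxy⟩ := exists_ne_of_ncard_eq_two (hreg (f s.vertex)).2
    obtain ⟨x, rfl⟩ := hsurj x
    obtain ⟨y, rfl⟩ := hsurj y
    have hx' := arc_of_refutes hreg hgeo hdb hf hF hx (h.2 x (List.mem_finRange x))
    have hy' := arc_of_refutes hreg hgeo hdb hf hF hy (h.2 y (List.mem_finRange y))
    exact hxy (congrArg f (List.eq_of_mem_of_length_lt_two h.1 (Pattern.mem_preds.2 hx')
      (Pattern.mem_preds.2 hy')))

lemma Branching.avoided_of_checkAll [Fintype V] (hcard : Fintype.card V = 18)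
    (hreg : IsDiregular A 2)
    (hgeo : IsKGeodetic A 3) {l : List Branching} {db : List Pattern}
    (hdb : ∀ H ∈ db, H.Avoided A) (h : checkAll l db = true) :
    ∀ s ∈ l, s.pattern.Avoided A := by
  induction l generalizing db with
  | nil => simp
  | cons s t ih =>
    simp only [checkAll, Bool.and_eq_true] at h
    have hs := avoided_of_check hcard hreg hgeo hdb h.1
    simp only [List.forall_mem_cons]
    exact ⟨hs, ih (List.forall_mem_cons.2 ⟨hs, hdb⟩) h.2⟩

end Soundness

/-- The first part of the refutation `branchings`. -/
def branchingsA : List Branching := [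
  ⟨[[1, 2], [3, 4], [6], [7, 8], [9, 12], [10, 14], [13, 15], [], [], [10], [3, 17], [8, 17], [],
   [11], [], [], [1]], false, 11, []⟩,
  ⟨[[1, 2], [3, 4], [6], [7, 8], [9, 12], [10, 14], [13, 15], [], [], [10], [3, 17], [8, 17], [],
   [], [], [], [1]], false, 11, [(13, 0, [])]⟩,
  ⟨[[1], [4], [5, 6], [7, 8], [9, 12], [10, 14], [15], [], [], [], [3, 17], [8], [], [9], [4], [],
   [1]], true, 14, []⟩,
  ⟨[[1], [3, 4], [5, 6], [7, 8], [9, 12], [10, 14], [13, 15], [], [], [], [3, 17], [8], [11], [9],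
   [], [], [1, 17]], false, 4, [(14, 0, [])]⟩,
  ⟨[[1], [3, 4], [5, 6], [7, 8], [9, 12], [10, 14], [13, 15], [], [], [10], [3, 17], [8], [11],
   [], [], [], [1, 17]], false, 9, [(13, 0, [])]⟩,
  ⟨[[1], [3, 4], [5, 6], [7, 8], [9, 12], [10, 14], [13, 15], [], [], [10], [3, 17], [8], [],
   [11], [], [], [1, 17]], false, 11, [(12, 0, [])]⟩,
  ⟨[[1], [3, 4], [5, 6], [7, 8], [9, 12], [10, 14], [13, 15], [], [], [10], [3, 17], [8], [], [],
   [], [], [1, 17]], false, 11, [(12, 1, []), (13, 0, [])]⟩,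
  ⟨[[1, 2], [3, 4], [5, 6], [7, 8], [9, 12], [10, 14], [13, 15], [], [], [10], [3, 17], [8], [],
   [], [], [], [1]], false, 17, [(11, 5, []), (16, 0, [])]⟩,
  ⟨[[1, 2], [3, 4], [5, 6], [7, 8], [9, 12], [10, 14], [13, 15], [], [], [10], [3], [8], [], [],
   [], [], [1]], true, 10, [(17, 0, [])]⟩,
  ⟨[[1, 2], [3, 4], [6], [7, 8], [9], [10, 14], [13, 15], [15], [], [], [3, 12], [], [], [], [],
   [11], [1], [10]], false, 7, []⟩,
  ⟨[[1, 2], [3, 4], [6], [7, 8], [9, 12], [10, 14], [13, 15], [], [], [11], [3, 12], [8], [], [],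
   [9], [11], [1], [10]], false, 15, [(7, 0, [])]⟩,
  ⟨[[1, 2], [3, 4], [6], [7, 8], [9, 12], [10, 14], [13, 15], [], [], [11], [3, 12], [8], [], [],
   [], [11], [1], [10]], false, 9, [(14, 0, [])]⟩,
  ⟨[[1, 2], [3, 4], [6], [7, 8], [9, 12], [10, 14], [13, 15], [], [], [11], [3, 12], [8], [], [],
   [], [], [1], [10]], false, 11, [(15, 0, [])]⟩,
  ⟨[[1, 2], [3, 4], [6], [7, 8], [9, 12], [10, 14], [13, 15], [], [], [], [3, 12], [8], [], [11],
   [], [], [1], [10]], false, 11, [(9, 1, [(13, 15)])]⟩,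
  ⟨[[1, 2], [3, 4], [6], [7, 8], [9, 12], [10, 14], [13, 15], [], [], [], [3, 12], [8], [], [],
   [], [], [1], [10]], false, 11, [(9, 1, []), (13, 0, [])]⟩,
  ⟨[[1], [3, 4], [5, 6], [7, 8], [9, 12], [10, 14], [13, 15], [], [], [], [3, 4], [8], [], [],
   [16], [], [1], [10]], true, 14, []⟩,
  ⟨[[1], [3, 4], [5, 6], [7, 8], [9, 12], [10, 14], [13, 15], [], [], [], [3, 4], [8], [], [], [],
   [], [1], [10]], true, 14, [(16, 0, [])]⟩,
  ⟨[[1, 2], [3, 4], [5, 6], [7, 8], [9, 12], [10, 14], [13, 15], [], [], [], [3], [8], [], [], [],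
   [], [1], [10]], true, 10, [(4, 0, []), (12, 2, [])]⟩,
  ⟨[[1, 2], [3, 4], [5, 6], [7, 8], [9, 12], [10, 14], [13, 15], [], [], [], [3], [8], [], [], [],
   [], [1]], false, 10, [(9, 9, []), (17, 0, [])]⟩,
  ⟨[[1], [3, 4], [5, 6], [7, 8], [], [10, 14], [13, 15], [], [10], [], [9, 16], [8], [5], [], [],
   [], [1], [3]], false, 16, []⟩,
  ⟨[[1], [3, 4], [5, 6], [7, 8], [9], [10, 14], [13, 15], [], [10], [], [9], [8], [5], [], [], [],
   [1], [3, 4]], true, 10, [(16, 0, [])]⟩,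
  ⟨[[1], [3, 4], [5, 6], [7, 8], [9], [10, 14], [13, 15], [], [10], [], [9], [8], [], [], [], [],
   [1], [3, 4]], false, 5, [(12, 0, [])]⟩]

def branchingsB : List Branching := [
  ⟨[[1], [3, 4], [5, 6], [7, 8], [9, 12], [10, 14], [13, 15], [], [], [], [9], [7, 8], [], [], [],
   [], [1], [3, 4]], false, 10, [(8, 0, [])]⟩,
  ⟨[[1], [3, 4], [5, 6], [7, 8], [9, 12], [10, 14], [13, 15], [], [], [], [], [7, 8], [], [], [],
   [], [1], [3, 4]], false, 9, [(10, 0, []), (13, 0, [(5, 6), (10, 13), (14, 15)])]⟩,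
  ⟨[[1, 2], [3], [5, 6], [7, 8], [9, 12], [10, 14], [13, 15], [], [], [], [], [7], [], [4, 17],
   [], [], [1], [3]], false, 17, []⟩,
  ⟨[[1, 2], [3, 4], [5, 6], [7], [9, 12], [10, 14], [13, 15], [], [], [], [], [7, 8], [], [4, 11],
   [], [], [1], [3]], false, 13, []⟩,
  ⟨[[1, 2], [3, 4], [5, 6], [7, 8], [9, 12], [10, 14], [13, 15], [], [], [], [], [7, 8], [], [4],
   [], [], [1], [3]], true, 13, [(11, 0, []), (17, 1, [])]⟩,
  ⟨[[1, 2], [3, 4], [5, 6], [7, 8], [9, 12], [10, 14], [13, 15], [], [], [], [], [7, 8], [], [],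
   [], [], [1], [3]], false, 4, [(13, 0, []), (17, 3, []), (10, 0, [(5, 6), (10, 13), (14, 15)])]⟩,
  ⟨[[1], [3, 4], [5, 6], [7, 8], [9, 12], [10, 14], [13], [2, 16], [], [], [], [8], [], [], [],
   [7], [1], [3]], true, 16, []⟩,
  ⟨[[1], [3, 4], [5, 6], [7, 8], [9, 12], [10, 14], [13], [2], [], [], [], [8], [], [], [], [7],
   [1], [3]], true, 7, [(16, 0, [])]⟩,
  ⟨[[1, 2], [3, 4], [5, 6], [7, 8], [9, 12], [10, 14], [13, 15], [], [], [6], [], [8, 15], [], [],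
   [], [7], [1], [3]], false, 2, [(7, 0, []), (8, 0, [(7, 8), (11, 15)]), (17, 11, [(1, 2), (3,
   6), (4, 5), (7, 13), (8, 15), (9, 10), (12, 14), (16, 17)])]⟩,
  ⟨[[1, 2], [3, 4], [5, 6], [7, 8], [9, 12], [10, 14], [13, 15], [], [], [], [], [8, 15], [], [],
   [], [7], [1], [3]], false, 6, [(9, 0, [])]⟩,
  ⟨[[1], [3, 4], [5, 6], [7, 8], [9, 12], [10, 14], [13], [], [], [], [], [8], [2, 16], [], [],
   [7], [1], [3]], true, 16, []⟩,
  ⟨[[1], [3], [5, 6], [7, 8], [9, 12], [10, 14], [13], [], [], [], [], [8], [2, 17], [], [], [7],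
   [1], [3]], true, 17, []⟩,
  ⟨[[1], [3, 4], [5, 6], [7, 8], [9, 12], [10, 14], [13, 15], [], [6], [], [], [8], [2], [], [],
   [7], [1], [3]], true, 12, [(16, 1, []), (17, 0, [])]⟩,
  ⟨[[2], [3], [6], [7, 8], [9], [14], [13, 15], [], [6, 14], [15], [9], [8], [5], [], [], [7],
   [2], [3]], true, 11, []⟩,
  ⟨[[2], [3], [5, 6], [7, 8], [9], [10, 14], [13, 15], [], [6, 14], [15], [9], [8], [], [], [],
   [7], [2], [3]], false, 5, [(12, 0, [])]⟩,
  ⟨[[1, 2], [3, 4], [5, 6], [7, 8], [9, 12], [10, 14], [13, 15], [], [5], [], [9], [], [], [], [],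
   [], [2]], false, 10, [(11, 18, [(1, 2), (3, 5), (4, 6), (7, 14), (8, 10), (9, 13), (12, 15)])]⟩,
  ⟨[[1, 2], [3, 4], [5, 6], [7, 8], [9, 12], [10, 14], [13, 15], [], [6], [15], [9], [8], [], [],
   [], [7], [2], [3]], true, 8, [(5, 0, []), (14, 1, [])]⟩,
  ⟨[[1, 2], [3, 4], [5, 6], [7, 8], [9, 12], [10, 14], [13, 15], [], [6], [15], [], [8], [], [],
   [], [7], [2], [3]], false, 9, [(10, 0, [])]⟩,
  ⟨[[1, 2], [3, 4], [5, 6], [7, 8], [9, 12], [10, 14], [13, 15], [], [6], [15], [], [8], [], [],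
   [], [7], [1], [3]], false, 2, [(12, 5, []), (16, 0, [(0, 16)])]⟩,
  ⟨[[1, 2], [3, 4], [5, 6], [7, 8], [9, 12], [10, 14], [], [], [], [15], [11], [6, 8], [11], [17],
   [], [], [1], [3]], false, 12, []⟩,
  ⟨[[1, 2], [3, 4], [5, 6], [7, 8], [9, 12], [10, 14], [13], [], [], [15], [11], [6, 8], [11], [],
   [9], [7], [1], [3]], false, 17, [(13, 0, []), (6, 23, [(5, 6), (14, 13), (15, 14), (17, 15),
   (10, 17)])]⟩,
  ⟨[[1, 2], [3, 4], [5, 6], [7, 8], [9, 12], [10, 14], [13, 15], [], [], [15], [], [6, 8], [11],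
   [], [9], [7], [1], [3]], false, 11, [(10, 0, [])]⟩]

def branchingsC : List Branching := [
  ⟨[[1, 2], [3, 4], [5, 6], [7, 8], [9, 12], [10, 14], [13, 15], [], [], [15], [11], [6, 8], [],
   [], [9], [7], [1], [3]], false, 11, [(12, 1, [])]⟩,
  ⟨[[1, 2], [3, 4], [5, 6], [7, 8], [9, 12], [10, 14], [13, 15], [], [], [15], [], [6, 8], [], [],
   [9], [7], [1], [3]], false, 11, [(10, 0, []), (12, 1, [])]⟩,
  ⟨[[1, 2], [3, 4], [5, 6], [7, 8], [9, 12], [10, 14], [13, 15], [], [], [15], [], [6, 8], [], [],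
   [], [7], [1], [3]], false, 9, [(14, 0, [])]⟩,
  ⟨[[1, 2], [3, 4], [5, 6], [7, 8], [9, 12], [10, 14], [13, 15], [], [], [15], [], [8], [], [],
   [], [7], [1], [3]], false, 6, [(8, 6, []), (11, 0, [])]⟩,
  ⟨[[1, 2], [3, 4], [5, 6], [7, 8], [9, 12], [10, 14], [13, 15], [], [], [], [], [8], [], [], [],
   [7], [1], [3]], false, 15, [(9, 0, []), (11, 16, [])]⟩,
  ⟨[[1, 2], [3, 4], [5, 6], [7, 8], [9, 12], [10, 14], [13, 15], [], [], [], [], [8], [], [], [],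
   [], [1], [3]], false, 7, [(11, 21, []), (15, 0, []), (14, 0, [(5, 6), (10, 13), (14, 15)])]⟩,
  ⟨[[1, 2], [3, 4], [5, 6], [7, 8], [9, 12], [10, 14], [13, 15], [], [], [], [], [8], [], [], [],
   [], [1]], false, 3, [(10, 31, []), (17, 0, []), (13, 31, [(5, 6), (10, 13), (14, 15)])]⟩,
  ⟨[[1], [3], [5, 6], [7, 8], [9, 12], [10, 14], [13, 15], [], [], [], [], [8], [13], [3], [1,
   16], [], [], [7]], true, 13, []⟩,
  ⟨[[1], [3], [5, 6], [7, 8], [9, 12], [10, 14], [13, 15], [], [], [], [], [8], [], [3], [1, 16],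
   [], [], [7]], false, 13, [(12, 0, [])]⟩,
  ⟨[[1], [4], [5, 6], [7, 8], [9, 12], [10, 14], [13, 15], [], [], [], [], [7], [], [3], [1, 16],
   [4], [], [13]], true, 15, []⟩,
  ⟨[[1], [3], [5, 6], [7, 8], [9, 12], [10, 14], [13, 15], [], [], [], [], [7], [], [3], [1, 16],
   [], [], [4, 13]], true, 13, []⟩,
  ⟨[[1, 2], [3, 4], [5, 6], [7, 8], [9, 12], [10, 14], [13, 15], [], [], [], [], [7, 8], [], [3,
   4], [1, 16], [0], [], [13]], true, 15, []⟩,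
  ⟨[[1, 2], [3, 4], [5, 6], [7, 8], [9, 12], [10, 14], [13, 15], [], [], [], [], [7, 8], [], [3,
   4], [1, 16], [], [], [13]], true, 15, [(0, 0, [])]⟩,
  ⟨[[1, 2], [3, 4], [5, 6], [7, 8], [9, 12], [10, 14], [13, 15], [], [], [], [], [7, 8], [], [3],
   [1, 16], [], [], [13]], false, 4, [(13, 0, []), (15, 3, []), (17, 2, [])]⟩,
  ⟨[[1, 2], [3, 4], [5, 6], [7, 8], [9, 12], [14], [13, 15], [], [], [], [12], [7, 8], [15], [3,
   17], [1, 16], [0]], true, 15, []⟩,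
  ⟨[[1, 2], [3, 4], [5, 6], [7, 8], [9, 12], [14], [13, 15], [], [], [], [12], [7, 8], [15], [3,
   17], [1, 16]], true, 15, [(0, 0, [])]⟩,
  ⟨[[1, 2], [3, 4], [5, 6], [7, 8], [9, 12], [10, 14], [13, 15], [], [], [], [12], [7, 8], [13],
   [3, 17], [1, 16]], true, 12, [(15, 0, [])]⟩,
  ⟨[[1, 2], [3, 4], [5, 6], [7, 8], [9, 12], [10, 14], [13, 15], [], [], [], [], [7, 8], [13], [3,
   17], [1, 16]], false, 12, [(10, 0, [])]⟩,
  ⟨[[1, 2], [3, 4], [5, 6], [7, 8], [9, 12], [10, 14], [13, 15], [], [], [], [], [7, 8], [13],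
   [3], [1, 16]], true, 13, [(17, 0, [])]⟩,
  ⟨[[1, 2], [3, 4], [5, 6], [7, 8], [9, 12], [10, 14], [13, 15], [], [], [], [], [7, 8], [], [3],
   [1, 16]], false, 13, [(12, 0, []), (17, 5, [])]⟩,
  ⟨[[1, 2], [3, 4], [6], [7, 8], [9, 12], [10, 14], [13, 15], [], [], [], [7, 11], [8, 17], [13],
   [17], [1, 16]], false, 12, []⟩,
  ⟨[[1, 2], [3, 4], [6], [7, 8], [9, 12], [10, 14], [13, 15], [], [], [], [7], [8, 17], [13],
   [17], [1, 16]], false, 11, [(10, 0, [])]⟩]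

def branchingsD : List Branching := [
  ⟨[[1, 2], [3, 4], [5, 6], [7, 8], [9, 12], [10], [13, 15], [], [], [], [7], [8], [15], [3, 17],
   [1], [0], [17]], true, 15, []⟩,
  ⟨[[1, 2], [3, 4], [5, 6], [7, 8], [9, 12], [10, 14], [13, 15], [], [], [], [7], [8], [15], [3,
   17], [1], [], [17]], true, 15, [(0, 0, [])]⟩,
  ⟨[[1, 2], [3, 4], [5, 6], [7, 8], [9, 12], [10, 14], [13, 15], [], [], [], [7], [8], [13], [3,
   17], [1], [], [17]], true, 12, [(15, 0, [])]⟩,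
  ⟨[[1, 2], [3, 4], [5, 6], [7, 8], [9, 12], [10, 14], [13, 15], [], [], [], [7], [8], [13], [3,
   17], [1, 16]], false, 17, [(11, 3, []), (16, 0, [])]⟩,
  ⟨[[1, 2], [3, 4], [5, 6], [7, 8], [9, 12], [10, 14], [13, 15], [], [], [], [7], [8], [13], [3],
   [1, 16]], true, 13, [(17, 0, [])]⟩,
  ⟨[[1, 2], [3, 4], [], [7, 8], [9, 12], [10, 14], [13, 15], [], [], [], [], [4, 8], [], [3], [1,
   16], [], [], [13]], false, 11, []⟩,
  ⟨[[1, 2], [3, 4], [5, 6], [7, 8], [9, 12], [14], [13, 15], [], [], [], [7], [8], [], [3, 4], [1,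
   16], [0], [], [13]], true, 15, []⟩,
  ⟨[[1, 2], [3, 4], [5, 6], [7, 8], [9, 12], [14], [13, 15], [], [], [], [7], [8], [], [3, 4], [1,
   16], [], [], [13]], true, 15, [(0, 0, [])]⟩,
  ⟨[[1, 2], [3, 4], [5, 6], [7, 8], [9, 12], [10, 14], [13, 15], [], [], [], [7], [8], [], [3],
   [1, 16], [], [], [13]], false, 4, [(11, 2, []), (13, 0, []), (15, 20, [(7, 8)]), (17, 19, [(7,
   8)])]⟩,
  ⟨[[1, 2], [3, 4], [5, 6], [7, 8], [9, 12], [10, 14], [13, 15], [], [], [], [7], [8], [], [3],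
   [1, 16]], false, 13, [(12, 4, []), (17, 0, [])]⟩,
  ⟨[[1, 2], [3, 4], [5, 6], [7, 8], [9, 12], [10, 14], [13, 15], [], [], [], [], [8], [], [3], [1,
   16]], false, 7, [(10, 0, []), (11, 12, []), (17, 23, [(7, 8), (11, 17)])]⟩,
  ⟨[[1, 2], [3, 4], [], [7, 8], [9, 12], [10, 14], [13], [], [], [], [], [4, 8], [], [11], [1,
   16], [12], [], [3]], false, 11, []⟩,
  ⟨[[1, 2], [3, 4], [], [7, 8], [9, 12], [10, 14], [13, 15], [], [], [], [], [4, 8], [], [], [1,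
   16], [12], [], [3]], false, 11, [(13, 0, [])]⟩,
  ⟨[[1, 2], [3, 4], [], [7, 8], [9, 12], [10, 14], [13, 15], [], [], [17], [], [8], [], [], [1,
   16], [12], [], [3]], false, 4, [(11, 0, [])]⟩,
  ⟨[[1, 2], [3, 4], [5, 6], [7, 8], [9, 12], [10, 14], [13, 15], [], [], [17], [], [8], [], [],
   [1, 16], [17], [], [3]], true, 15, [(12, 0, [])]⟩,
  ⟨[[1, 2], [3, 4], [5, 6], [7, 8], [9, 12], [10, 14], [13, 15], [], [], [], [], [8], [], [], [1,
   16], [17], [], [3]], false, 17, [(9, 0, [])]⟩,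
  ⟨[[1, 2], [3, 4], [5, 6], [7, 8], [9, 12], [10, 14], [13, 15], [], [], [17], [], [8], [], [],
   [1, 16], [], [], [3]], false, 17, [(15, 1, [])]⟩,
  ⟨[[1, 2], [3, 4], [5, 6], [7, 8], [9, 12], [10, 14], [13, 15], [], [], [], [], [8], [], [], [1,
   16], [], [], [3]], false, 17, [(9, 0, []), (15, 1, [])]⟩,
  ⟨[[1, 2], [3, 4], [5, 6], [7, 8], [9, 12], [10, 14], [13, 15], [], [], [], [], [8], [], [], [1,
   16]], false, 3, [(13, 7, []), (17, 0, [])]⟩,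
  ⟨[[1, 2], [3, 4], [5, 6], [7, 8], [9, 12], [10, 14], [13, 15], [], [], [], [], [8], [], [],
   [1]], true, 14, [(16, 0, [])]⟩,
  ⟨[[1, 2], [3, 4], [5, 6], [7, 8], [9, 12], [10, 14], [13, 15], [], [], [], [], [8]], false, 1,
   [(14, 0, []), (16, 35, []), (15, 0, [(5, 6), (10, 13), (14, 15)])]⟩,
  ⟨[[1, 2], [3, 4], [5, 6], [7, 8], [9, 12], [10, 14], [13, 15], [14], [], [], [8], [], [], [3],
   [12]], false, 1, [(16, 49, [(1, 2), (4, 5), (6, 4), (3, 6), (12, 10), (15, 12), (7, 15), (9,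
   14), (13, 9), (8, 13)])]⟩]

def branchingsE : List Branching := [
  ⟨[[1, 2], [3, 4], [5, 6], [7, 8], [9, 12], [10, 14], [13, 15], [], [], [], [8], [], [], [3],
   [12]], false, 14, [(7, 0, []), (11, 1, [(1, 2), (3, 5), (4, 6), (7, 10), (8, 14), (9, 13), (12,
   15)])]⟩,
  ⟨[[1, 2], [3, 4], [5, 6], [7, 8], [9, 12], [10, 14], [13, 15], [], [], [10], [8], [], [13],
   [3]], false, 12, [(14, 0, []), (11, 2, [(3, 4), (7, 9), (8, 12)])]⟩,
  ⟨[[1, 2], [3, 4], [5, 6], [7, 8], [9, 12], [10, 14], [13, 15], [], [], [10], [8], [], [], [3]],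
   false, 13, [(12, 0, []), (11, 3, [(1, 2), (4, 5), (6, 4), (3, 6), (9, 10), (13, 9), (8, 13),
   (14, 8), (12, 14), (15, 12), (7, 15)])]⟩,
  ⟨[[1, 2], [3, 4], [5, 6], [7, 8], [9, 12], [10, 14], [13, 15], [], [15], [], [], [6], [], [],
   [], [9], [5, 11], [4]], true, 11, [(7, 4, [(7, 8)]), (12, 4, [(3, 4), (7, 9), (8, 12)])]⟩,
  ⟨[[1, 2], [3, 4], [5, 6], [7, 8], [9, 12], [10, 14], [13, 15], [], [15], [], [], [6], [], [],
   [], [9], [5, 11]], false, 4, [(17, 0, []), (14, 1, [(3, 4), (5, 6), (7, 12), (8, 9), (10, 15),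
   (13, 14)])]⟩,
  ⟨[[1, 2], [3, 4], [5, 6], [7, 8], [9, 12], [10, 14], [13, 15], [], [15], [], [8], [], [], [],
   [], [9], [5, 11], [3]], false, 6, [(11, 0, []), (12, 2, [(1, 2), (4, 5), (6, 4), (3, 6), (12,
   14), (13, 12), (7, 13), (9, 10), (15, 9), (8, 15)])]⟩,
  ⟨[[1, 2], [3, 4], [5, 6], [7, 8], [9, 12], [10, 14], [13, 15], [], [15], [10], [8], [], [], [],
   [], [9], [5, 11]], false, 3, [(13, 3, []), (17, 0, [])]⟩,
  ⟨[[1, 2], [3, 4], [5, 6], [7, 8], [9, 12], [10, 14], [13, 15], [], [15], [10], [8], [4], [], [],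
   [], [9], [], [3]], true, 11, [(7, 8, [(7, 8)]), (14, 8, [(1, 2), (3, 5), (4, 6), (7, 10), (8,
   14), (9, 13), (12, 15)]), (13, 8, [(1, 2), (4, 5), (6, 4), (3, 6), (9, 10), (13, 9), (8, 13),
   (14, 8), (12, 14), (15, 12), (7, 15)]), (16, 0, [(1, 2), (4, 6), (5, 4), (3, 5), (12, 13), (14,
   12), (7, 14), (9, 15), (10, 9), (8, 10), (11, 16)])]⟩,
  ⟨[[2], [3, 4], [5, 6], [7], [9, 12], [10, 14], [13, 15], [], [15], [], [], [4], [2], [], [], [],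
   [5], [16]], true, 12, []⟩,
  ⟨[[2], [3, 4], [5, 6], [7, 8], [9, 12], [10, 14], [13, 15], [], [15], [10], [], [3, 4], [], [],
   [], [], [5, 6], [16]], false, 2, [(12, 0, []), (7, 0, [(3, 4), (5, 6), (7, 12), (8, 9), (14,
   15), (13, 14), (10, 13)])]⟩,
  ⟨[[2], [3, 4], [5], [7], [9, 12], [10, 14], [13, 15], [], [15], [], [], [4], [16], [], [], [],
   [5, 6]], false, 16, [(17, 1, [(0, 17), (2, 16)])]⟩,
  ⟨[[2], [3, 4], [5, 6], [7, 8], [9, 12], [10, 14], [13, 15], [], [15], [10], [], [3, 4], [], [],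
   [], [], [5, 6]], false, 16, [(12, 0, []), (17, 1, [(0, 17), (2, 16)]), (7, 0, [(3, 4), (5, 6),
   (7, 12), (8, 9), (14, 15), (13, 14), (10, 13)])]⟩,
  ⟨[[1, 2], [3, 4], [5, 6], [7, 8], [9, 12], [10, 14], [13, 15], [], [15], [10], [8], [4], [], [],
   [], [9], [5, 6]], false, 3, [(13, 9, []), (11, 0, [(1, 11)]), (17, 4, [(3, 4), (5, 6), (7, 12),
   (8, 9), (10, 15), (11, 17), (13, 14)])]⟩,
  ⟨[[1, 2], [3, 4], [5, 6], [7, 8], [9, 12], [10, 14], [13, 15], [], [15], [10], [8], [], [], [],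
   [], [9], [5, 6]], false, 4, [(11, 0, []), (14, 10, [(3, 4), (5, 6), (7, 12), (8, 9), (10, 15),
   (13, 14)])]⟩,
  ⟨[[1, 2], [3, 4], [5, 6], [7, 8], [9, 12], [10, 14], [13, 15], [], [15], [10], [8], [], [], [],
   [], [9], [5]], true, 16, [(11, 7, []), (7, 15, [(7, 8), (11, 16)]), (12, 15, [(3, 4), (7, 9),
   (8, 12), (11, 16)]), (6, 0, [(3, 4), (5, 6), (7, 12), (8, 9), (10, 15), (13, 14)]), (13, 15,
   [(1, 2), (4, 5), (6, 4), (3, 6), (9, 10), (13, 9), (8, 13), (14, 8), (12, 14), (15, 12), (7,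
   15), (11, 16)])]⟩,
  ⟨[[1, 2], [3], [], [7, 8], [9, 12], [10, 14], [13, 15], [], [], [], [8], [1], [], [12], [7],
   [9], [5], [3, 4]], false, 17, []⟩,
  ⟨[[1, 2], [3, 4], [], [7, 8], [9, 12], [10, 14], [13, 15], [15], [], [], [8], [1], [14], [12],
   [7], [9], [5], [4]], false, 3, [(17, 0, [])]⟩,
  ⟨[[1, 2], [3, 4], [], [7, 8], [9, 12], [10, 14], [13, 15], [15], [], [], [8], [], [14], [12],
   [7], [9], [5], [4]], false, 1, [(11, 0, [])]⟩,
  ⟨[[1, 2], [3, 4], [5, 6], [7, 8], [9, 12], [10, 14], [13, 15], [15], [], [], [8], [], [14], [],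
   [7], [9], [5], [4]], false, 12, [(13, 0, []), (11, 19, [(3, 4), (7, 9), (8, 12)]), (15, 3, [(1,
   2), (4, 6), (5, 4), (3, 5), (9, 15), (14, 9), (8, 14), (13, 8), (12, 13), (10, 12), (7, 10),
   (16, 17)])]⟩,
  ⟨[[1, 2], [3, 4], [5, 6], [7, 8], [9, 12], [10, 14], [13, 15], [15], [], [], [8], [], [], [],
   [7], [9], [5], [4]], false, 14, [(12, 0, []), (9, 4, [(7, 8), (10, 14)]), (11, 20, [(1, 2), (3,
   5), (4, 6), (7, 10), (8, 14), (9, 13), (12, 15)])]⟩,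
  ⟨[[1, 2], [3, 4], [5, 6], [7, 8], [9, 12], [10, 14], [13, 15], [15], [], [10], [8], [], [], [],
   [], [9], [5], [4]], false, 7, [(14, 0, []), (11, 21, [(7, 8)]), (10, 5, [(1, 2), (4, 6), (5,
   4), (3, 5), (9, 15), (10, 9), (8, 10), (13, 8), (12, 13), (14, 12), (7, 14), (16, 17)])]⟩,
  ⟨[[1, 2], [3, 4], [5, 6], [7, 8], [9, 12], [10, 14], [13, 15], [15], [], [10], [8], [], [], [],
   [], [9], [5]], false, 4, [(17, 0, []), (14, 18, [(3, 4), (5, 6), (8, 9), (12, 8), (7, 12), (10,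
   15), (13, 14)])]⟩]

def branchingsF : List Branching := [
  ⟨[[1, 2], [3, 4], [5, 6], [7, 8], [9, 12], [10, 14], [13, 15], [], [], [10], [8], [], [], [],
   [], [9], [5]], false, 15, [(7, 0, []), (8, 7, []), (11, 23, [(1, 2), (4, 5), (6, 4), (3, 6),
   (9, 10), (13, 9), (7, 13), (12, 14), (15, 12), (8, 15)])]⟩,
  ⟨[[1, 2], [3, 4], [5, 6], [7, 8], [9, 12], [10, 14], [13, 15], [], [], [10], [8], [], [], [],
   [], [], [5]], false, 9, [(15, 0, []), (11, 24, [(3, 4), (8, 9), (12, 8), (7, 12)])]⟩,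
  ⟨[[1, 2], [3, 4], [5, 6], [7, 8], [9, 12], [10, 14], [13, 15], [5], [], [10]], false, 9, [(11,
   25, [(3, 4), (8, 9), (12, 8), (7, 12)]), (15, 21, [(1, 2), (4, 6), (5, 4), (3, 5), (12, 13),
   (14, 12), (7, 14), (9, 15), (10, 9), (8, 10)])]⟩,
  ⟨[[1, 2], [3, 4], [5, 6], [7, 8], [9, 12], [10, 14], [13, 15], [], [], [10], [8]], false, 5,
   [(7, 0, []), (16, 1, [])]⟩,
  ⟨[[1, 2], [3, 4], [5, 6], [7, 8], [9, 12], [10, 14], [13, 15], [], [], [], [8]], false, 10, [(9,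
   0, []), (11, 27, [(1, 2), (3, 5), (4, 6), (8, 10), (14, 8), (7, 14), (9, 13), (12, 15)])]⟩,
  ⟨[[1, 2], [3, 4], [5, 6], [7, 8], [9, 12], [10, 14], [13, 15]], false, 8, [(10, 0, []), (11, 28,
   []), (13, 0, [(5, 6), (10, 13), (14, 15)])]⟩,
  ⟨[[1, 2], [3, 4], [5, 6], [7, 8], [9], [10, 14], [13, 15]], true, 4, [(12, 0, [(3, 4), (8, 9),
   (12, 8), (7, 12)])]⟩,
  ⟨[[1, 2], [3, 4], [5, 6], [7, 8], [9], [10, 14], [13]], true, 6, [(15, 0, [(5, 6), (14, 13),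
   (15, 14), (10, 15)])]⟩,
  ⟨[[1, 2], [3, 4], [5, 6], [7, 8], [], [10, 14], [13]], true, 4, [(9, 0, [])]⟩,
  ⟨[[1, 2], [3, 4], [5, 6], [7, 8], [], [14], [13]], true, 5, [(10, 0, [])]⟩,
  ⟨[[1, 2], [3, 4], [5, 6], [7, 8], [], [], [13]], true, 5, [(14, 0, [])]⟩,
  ⟨[[1, 2], [3, 4], [5, 6], [7, 8]], true, 6, [(13, 0, [])]⟩,
  ⟨[[1, 2], [3, 4], [5, 6], [7]], true, 3, [(8, 0, [])]⟩,
  ⟨[[1, 2], [3, 4], [5, 6]], true, 3, [(7, 0, [])]⟩,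
  ⟨[[1, 2], [3, 4], [5]], true, 2, [(6, 0, [])]⟩,
  ⟨[[1, 2], [3, 4]], true, 2, [(5, 0, [])]⟩,
  ⟨[[1, 2], [3]], true, 1, [(4, 0, [])]⟩,
  ⟨[[1, 2]], true, 1, [(3, 0, [])]⟩,
  ⟨[[1]], true, 0, [(2, 0, [])]⟩,
  ⟨[], true, 0, [(1, 0, [])]⟩]

/-- A refutation of the empty pattern, which occurs in every digraph. -/
def branchings : List Branching :=
  branchingsA ++ branchingsB ++ branchingsC ++ branchingsD ++
  branchingsE ++ branchingsF

lemma checkAll_branchings : Branching.checkAll branchings [] = true := by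
  decide +kernel

lemma exists_pattern_eq_nil : ∃ s ∈ branchings, s.pattern = [] :=
  ⟨⟨[], true, 0, [(1, 0, [])]⟩, by simp [branchings, branchingsF], rfl⟩

/-- There are no diregular `(2,3,+3)`-digraphs, i.e. no diregular `3`-geodetic
digraph of degree `2` on `M(2,3) + 3 = 18` vertices. -/
theorem no_diregular_2_3_plus3 {V : Type*} [Fintype V] (A : V → V → Prop)
    (hirr : Irreflexive A) (hreg : IsDiregular A 2)
    (hgeo : IsKGeodetic A 3) :
    Fintype.card V ≠ moore 2 3 + 3 := by
  intro hcard
  replace hcard : Fintype.card V = 18 := hcard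
  obtain ⟨s, hs, hnil⟩ := exists_pattern_eq_nil
  refine Branching.avoided_of_checkAll hcard hreg hgeo (by simp) checkAll_branchings s hs
    (Fintype.equivFinOfCardEq hcard).symm (Equiv.injective _) fun a b hab => ?_
  simp [hnil, Pattern.arc_iff, Pattern.succs] at hab
end

section
/- Let z, z' be distinct vertices of a (d,k,+ε)-digraph H with out-degree exactly d at every vertex, for some ε ≥ 1, and suppose N^+(z) = N^+(z'). Then there exists a set X of ε − 1 vertices of H such that O(z) = {z'} ∪ X and O(z') = {z} ∪ X. -/
theorem isWalkFrom_singleton {V : Type*} (A : V → V → Prop) (u : V) : IsWalkFrom A u u [u] :=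
  ⟨List.IsChain.singleton u, rfl, rfl⟩

theorem IsWalkFrom.cons {V : Type*} {A : V → V → Prop} {u w v : V} {p : List V}
    (h : IsWalkFrom A w v p) (huw : A u w) : IsWalkFrom A u v (u :: p) := by
  obtain ⟨hc, hh, hl⟩ := h
  cases p with
  | nil => simp at hh
  | cons a q =>
    obtain rfl : a = w := by simpa using hh
    exact ⟨List.IsChain.cons_cons huw hc, rfl, by simpa using hl⟩

theorem IsWalkFrom.eq_singleton_or_cons {V : Type*} {A : V → V → Prop} {u v : V} {p : List V}
    (h : IsWalkFrom A u v p) :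
    (u = v ∧ p = [u]) ∨ ∃ w q, p = u :: q ∧ A u w ∧ IsWalkFrom A w v q := by
  obtain ⟨hc, hh, hl⟩ := h
  rcases p with _ | ⟨a, _ | ⟨b, q⟩⟩
  · simp at hh
  · simp_all
  · obtain rfl : a = u := by simpa using hh
    have hc' : A a b ∧ (b :: q).IsChain A := List.isChain_cons_cons.mp hc
    exact Or.inr ⟨b, b :: q, rfl, hc'.1, hc'.2, rfl, by simpa using hl⟩

theorem IsWalkFrom.length_pos {V : Type*} {A : V → V → Prop} {u v : V} {p : List V}
    (h : IsWalkFrom A u v p) : 0 < p.length := by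
  rcases h.eq_singleton_or_cons with ⟨-, rfl⟩ | ⟨w, q, rfl, -⟩ <;> simp

theorem IsWalkFrom.start_unique {V : Type*} {A : V → V → Prop} {u u' v v' : V} {p : List V}
    (h : IsWalkFrom A u v p) (h' : IsWalkFrom A u' v' p) : u = u' :=
  Option.some.inj (h.2.1.symm.trans h'.2.1)

theorem mem_ball_iff {V : Type*} {A : V → V → Prop} {l : ℕ} {u v : V} :
    v ∈ Ball A l u ↔ ∃ p, IsWalkFrom A u v p ∧ p.length ≤ l + 1 := by
  constructor
  · rintro ⟨m, hm, p, hp, hlen⟩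
    exact ⟨p, hp, by omega⟩
  · rintro ⟨p, hp, hlen⟩
    have := hp.length_pos
    exact ⟨p.length - 1, by omega, p, hp, by omega⟩

theorem ball_zero {V : Type*} (A : V → V → Prop) (u : V) : Ball A 0 u = {u} := by
  ext v
  rw [mem_ball_iff, Set.mem_singleton_iff]
  constructor
  · rintro ⟨p, hp, hlen⟩
    rcases hp.eq_singleton_or_cons with ⟨rfl, -⟩ | ⟨w, q, rfl, -, hq⟩
    · rfl
    · have := hq.length_pos
      simp at hlen
      simp [hlen] at this
  · rintro rfl
    exact ⟨[v], isWalkFrom_singleton A v, le_rfl⟩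

theorem ball_succ {V : Type*} (A : V → V → Prop) (l : ℕ) (u : V) :
    Ball A (l + 1) u = insert u (⋃ w ∈ Nout A u, Ball A l w) := by
  ext v
  simp only [Set.mem_insert_iff, Set.mem_iUnion, mem_ball_iff, exists_prop]
  constructor
  · rintro ⟨p, hp, hlen⟩
    rcases hp.eq_singleton_or_cons with ⟨rfl, -⟩ | ⟨w, q, rfl, huw, hq⟩
    · exact Or.inl rfl
    · exact Or.inr ⟨w, huw, q, hq, by simpa using hlen⟩
  · rintro (rfl | ⟨w, huw, q, hq, hlen⟩)
    · exact ⟨[v], isWalkFrom_singleton A v, by simp⟩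
    · exact ⟨u :: q, hq.cons huw, by simpa using hlen⟩

theorem IsKGeodetic.notMem_ball_of_adj {V : Type*} {A : V → V → Prop} {k l : ℕ}
    (hgeo : IsKGeodetic A k) (hl : l + 1 ≤ k) {u w : V} (huw : A u w) : u ∉ Ball A l w := by
  rw [mem_ball_iff]
  rintro ⟨p, hp, hlen⟩
  have h := hgeo u u _ _ (hp.cons huw) (isWalkFrom_singleton A u) (by simp; omega) (by simp)
  have := hp.length_pos
  simp_all

theorem IsKGeodetic.disjoint_ball {V : Type*} {A : V → V → Prop} {k l : ℕ}
    (hgeo : IsKGeodetic A k) (hl : l + 1 ≤ k) {u w w' : V} (huw : A u w) (huw' : A u w')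
    (hne : w ≠ w') : Disjoint (Ball A l w) (Ball A l w') := by
  refine Set.disjoint_left.mpr fun v hv hv' => hne ?_
  obtain ⟨p, hp, hlen⟩ := mem_ball_iff.mp hv
  obtain ⟨q, hq, hlen'⟩ := mem_ball_iff.mp hv'
  have h := hgeo u v _ _ (hp.cons huw) (hq.cons huw') (by simp; omega) (by simp; omega)
  rw [List.cons.inj h |>.2] at hp
  exact hp.start_unique hq

theorem moore_succ (d l : ℕ) : moore d (l + 1) = d * moore d l + 1 := by
  rw [moore, Finset.sum_range_succ', moore, Finset.mul_sum]
  simp [pow_succ']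

theorem IsKGeodetic.ncard_ball {V : Type*} [Finite V] {A : V → V → Prop} {d k : ℕ}
    (hgeo : IsKGeodetic A k) (hdeg : ∀ u, (Nout A u).ncard = d) {l : ℕ} (hl : l ≤ k) (u : V) :
    (Ball A l u).ncard = moore d l := by
  classical
  have := Fintype.ofFinite V
  induction l generalizing u with
  | zero => simp [ball_zero, moore]
  | succ l ih =>
    have hunion : (⋃ w ∈ Nout A u, Ball A l w) =
        ↑((Nout A u).toFinset.biUnion fun w => (Ball A l w).toFinset) := by
      ext; simp
    rw [ball_succ, Set.ncard_insert_of_notMem, moore_succ, hunion, Set.ncard_coe_finset,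
      Finset.card_biUnion]
    · rw [Finset.sum_congr rfl fun w _ =>
        (Set.ncard_eq_toFinset_card' (Ball A l w)).symm.trans (ih (by omega) w)]
      rw [Finset.sum_const, ← Set.ncard_eq_toFinset_card', hdeg, smul_eq_mul]
    · intro w hw w' hw' hne
      simpa [Function.onFun] using
        hgeo.disjoint_ball hl (Set.mem_toFinset.mp hw) (Set.mem_toFinset.mp hw') hne
    · simp only [Set.mem_iUnion, not_exists]
      exact fun w huw => hgeo.notMem_ball_of_adj hl huw

theorem ball_subset_insert_ball {V : Type*} {A : V → V → Prop} {z z' : V}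
    (hN : Nout A z = Nout A z') (k : ℕ) : Ball A k z ⊆ insert z (Ball A k z') := by
  cases k with
  | zero => simp [ball_zero]
  | succ l =>
    rw [ball_succ, ball_succ, hN]
    exact Set.insert_subset_insert (Set.subset_insert _ _)

theorem IsKGeodetic.notMem_ball_of_nout_eq {V : Type*} {A : V → V → Prop} {k : ℕ}
    (hgeo : IsKGeodetic A k) {z z' : V} (hne : z ≠ z') (hN : Nout A z = Nout A z') :
    z' ∉ Ball A k z := by
  cases k with
  | zero => simpa [ball_zero] using hne.symm
  | succ l =>
    rw [ball_succ, hN]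
    simp only [Set.mem_insert_iff, Set.mem_iUnion, not_or, not_exists]
    exact ⟨hne.symm, fun w hw => hgeo.notMem_ball_of_adj le_rfl hw⟩

/-- If `z, z'` are distinct vertices of a `(d,k,+ε)`-digraph (with out-degree
exactly `d` at every vertex), `ε ≥ 1`, and `N⁺(z) = N⁺(z')`, then there is a
set `X` of `ε - 1` vertices with `O(z) = {z'} ∪ X` and `O(z') = {z} ∪ X`. -/
theorem outliers_of_identical_outneighbourhoods {V : Type*} [Fintype V]
    (A : V → V → Prop) (d k ε : ℕ) (hε : 1 ≤ ε) (hirr : Irreflexive A)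
    (hdeg : ∀ u : V, (Nout A u).ncard = d) (hgeo : IsKGeodetic A k)
    (hcard : Fintype.card V = moore d k + ε)
    (z z' : V) (hzz' : z ≠ z') (hN : Nout A z = Nout A z') :
    ∃ X : Set V, X.ncard = ε - 1 ∧
      Outliers A k z = {z'} ∪ X ∧ Outliers A k z' = {z} ∪ X := by

  have hz' : z' ∉ Ball A k z := hgeo.notMem_ball_of_nout_eq hzz' hN
  have hz : z ∉ Ball A k z' := hgeo.notMem_ball_of_nout_eq hzz'.symm hN.symm
  have hsub := ball_subset_insert_ball hN k
  have hsub' := ball_subset_insert_ball hN.symm k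
  have hself : ∀ u, u ∈ Ball A k u := fun u =>
    mem_ball_iff.mpr ⟨[u], isWalkFrom_singleton A u, by simp⟩
  have hout : (Outliers A k z).ncard = ε := by
    have h := Set.ncard_add_ncard_compl (Ball A k z)
    rw [hgeo.ncard_ball hdeg le_rfl, Nat.card_eq_fintype_card, hcard] at h
    exact Nat.add_left_cancel h
  refine ⟨Outliers A k z \ {z'}, ?_, ?_, ?_⟩
  · rw [Set.ncard_sdiff_singleton_of_mem hz', hout]
  · rw [Set.singleton_union, Set.insert_sdiff_singleton, Set.insert_eq_of_mem hz']
  · ext v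
    have h₁ := @hsub v
    have h₂ := @hsub' v
    have h₃ := hself z
    have h₄ := hself z'
    simp only [Outliers, Set.mem_union, Set.mem_singleton_iff, Set.mem_sdiff, Set.mem_ofPred_eq,
      Set.mem_insert_iff] at *
    by_cases hvz : v = z
    · subst hvz; simp [hz]
    · by_cases hvz' : v = z'
      · subst hvz'; simp [h₄, hvz]
      · simp only [hvz, hvz', false_or, not_false_eq_true, and_true] at *
        exact ⟨mt h₁, mt h₂⟩
end
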